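/- arXiv:1204.3258 — 6 statements merged into one kernel-verified Lean document; each statement's English description precedes it below -/
import Mathlib

section
/- Let σ and τ be disjoint finite relational signatures, let 𝒞₁ be a strong amalgamation class of finite σ-structures with the Ramsey property, and let 𝒞₂ be a strong amalgamation class of finite τ-structures with the Ramsey property. Then the class 𝒞₁ ∧ 𝒞₂ of all finite (σ ∪ τ)-structures whose σ-reduct is in 𝒞₁ and whose τ-reduct is in 𝒞₂ also has the Ramsey property. -/
open FirstOrder FirstOrder.Language CategoryTheory

universe u v u' v' w

/-- The partition arrow `C → (B)^A_r`: for every colouring of the embeddings of `A` into `C`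
with `r` colours there is an embedding `g` of `B` into `C` such that the colouring is constant
on the copies of `A` inside the copy `g[B]` of `B`. -/
def RamseyArrow {L : FirstOrder.Language.{u, v}} (A B C : Bundled.{w} L.Structure) (r : ℕ) : Prop :=
  ∀ χ : (A ↪[L] C) → Fin r, ∃ g : B ↪[L] C,
    ∀ f₁ f₂ : A ↪[L] B, χ (g.comp f₁) = χ (g.comp f₂)

/-- A class of structures has the Ramsey property if for all members `A, B` and all `r : ℕ`
there is a member `C` with `C → (B)^A_r`. -/
def IsRamseyClass {L : FirstOrder.Language.{u, v}} (K : Set (Bundled.{w} L.Structure)) : Prop :=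
  ∀ A ∈ K, ∀ B ∈ K, ∀ r : ℕ, ∃ C ∈ K, RamseyArrow A B C r

/-- A strong amalgamation class of finite structures: all members are finite, the class is
closed under isomorphisms and induced substructures (equivalently: every finite structure
embedding into a member is a member), it has countably many members up to isomorphism, and
every amalgamation diagram has a strong amalgam in the class. -/
def IsStrongAmalgamationClass {L : FirstOrder.Language.{u, v}} (K : Set (Bundled.{w} L.Structure)) :
    Prop :=
  (∀ A ∈ K, Finite A) ∧
  (∀ A ∈ K, ∀ B : Bundled.{w} L.Structure, Finite B → Nonempty (B ↪[L] A) → B ∈ K) ∧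
  (∃ S : Set (Bundled.{w} L.Structure), S.Countable ∧
    ∀ A ∈ K, ∃ B ∈ S, Nonempty (A ≃[L] B)) ∧
  (∀ A ∈ K, ∀ B₁ ∈ K, ∀ B₂ ∈ K, ∀ e₁ : A ↪[L] B₁, ∀ e₂ : A ↪[L] B₂,
    ∃ C ∈ K, ∃ f₁ : B₁ ↪[L] C, ∃ f₂ : B₂ ↪[L] C,
      f₁.comp e₁ = f₂.comp e₂ ∧
      Set.range ⇑f₁ ∩ Set.range ⇑f₂ = Set.range ⇑(f₁.comp e₁))

/-- The `σ`-reduct of a bundled `(σ ∪ τ)`-structure. -/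
def sumReduct₁ {σ : FirstOrder.Language.{u, v}} {τ : FirstOrder.Language.{u', v'}}
    (A : Bundled.{w} (σ.sum τ).Structure) : Bundled.{w} σ.Structure :=
  ⟨A.α, @LHom.reduct σ (σ.sum τ) (LHom.sumInl : σ →ᴸ σ.sum τ) A.α A.str⟩

/-- The `τ`-reduct of a bundled `(σ ∪ τ)`-structure. -/
def sumReduct₂ {σ : FirstOrder.Language.{u, v}} {τ : FirstOrder.Language.{u', v'}}
    (A : Bundled.{w} (σ.sum τ).Structure) : Bundled.{w} τ.Structure :=
  ⟨A.α, @LHom.reduct τ (σ.sum τ) (LHom.sumInr : τ →ᴸ σ.sum τ) A.α A.str⟩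

/-- The class `𝒞₁ ∧ 𝒞₂` of all `(σ ∪ τ)`-structures whose `σ`-reduct is in `𝒞₁` and whose
`τ`-reduct is in `𝒞₂` (the disjoint union `σ ∪ τ` of the signatures is modelled by `σ.sum τ`). -/
def AndClass {σ : FirstOrder.Language.{u, v}} {τ : FirstOrder.Language.{u', v'}}
    (K₁ : Set (Bundled.{w} σ.Structure)) (K₂ : Set (Bundled.{w} τ.Structure)) :
    Set (Bundled.{w} (σ.sum τ).Structure) :=
  {A | sumReduct₁ A ∈ K₁ ∧ sumReduct₂ A ∈ K₂}

open FirstOrder.Language.Structure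

section Relational

variable {L : FirstOrder.Language.{u, v}} [L.IsRelational]

/-- The structure on `X` induced by a map into a structure of a relational language. -/
@[reducible] def pullbackStructure {X M : Type*} [L.Structure M] (f : X → M) : L.Structure X where
  funMap F := isEmptyElim F
  RelMap R v := RelMap R (f ∘ v)

/-- In a relational language, an injective map preserving and reflecting all relations is an
embedding. -/
def embeddingOfRel {M N : Type*} [L.Structure M] [L.Structure N] (f : M → N)
    (hf : Function.Injective f)
    (h : ∀ (n : ℕ) (R : L.Relations n) (v : Fin n → M), RelMap R (f ∘ v) ↔ RelMap R v) :
    M ↪[L] N where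
  toFun := f
  inj' := hf
  map_fun' F := isEmptyElim F
  map_rel' := h _

theorem pullback_mem {K : Set (Bundled.{w} L.Structure)} (hK : IsStrongAmalgamationClass K)
    {M : Bundled.{w} L.Structure} (hM : M ∈ K) {X : Type w} (f : X → M)
    (hf : Function.Injective f) : (⟨X, pullbackStructure f⟩ : Bundled.{w} L.Structure) ∈ K := by
  have := hK.1 M hM
  let : L.Structure X := pullbackStructure f
  exact hK.2.1 M hM ⟨X, pullbackStructure f⟩ (Finite.of_injective f hf)
    ⟨embeddingOfRel f hf fun _ _ _ => Iff.rfl⟩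

/-- A strong amalgamation class allows duplicating points: for every family `q : Y → C` of
points of `C` there is a member extending `C` by new points indexed by `Y` in which the new
point `y` can replace `q y` in any relation. -/
theorem exists_duplication {K : Set (Bundled.{w} L.Structure)}
    (hK : IsStrongAmalgamationClass K) {C : Bundled.{w} L.Structure} (hC : C ∈ K)
    (Y : Type w) [Finite Y] : ∀ q : Y → C, ∃ E ∈ K, ∃ h : C ⊕ Y → E, Function.Injective h ∧
      ∀ (n : ℕ) (R : L.Relations n) (v : Fin n → C ⊕ Y),
        (∀ i j, Sum.elim id q (v i) = Sum.elim id q (v j) → v i = v j) →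
        (RelMap R (h ∘ v) ↔ RelMap R (Sum.elim id q ∘ v)) := by
  induction Y using Finite.induction_empty_option with
  | of_equiv e ih =>
    intro q
    obtain ⟨E, hE, h, hinj, hrel⟩ := ih (q ∘ e)
    have hq : Sum.elim id (q ∘ e) ∘ Sum.map id e.symm = Sum.elim (id : C → C) q := by
      ext (x | y) <;> simp
    have hm : Function.Injective (Sum.map (id : C → C) e.symm) :=
      Function.injective_id.sumMap e.symm.injective
    refine ⟨E, hE, h ∘ Sum.map id e.symm, hinj.comp hm, fun n R v hv => ?_⟩
    have key := hrel n R (Sum.map id e.symm ∘ v) fun i j hij =>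
      congrArg (Sum.map id e.symm) (hv i j (by rw [← hq]; exact hij))
    rwa [← Function.comp_assoc, ← Function.comp_assoc, hq] at key
  | h_empty =>
    intro q
    refine ⟨C, hC, Sum.elim id q, ?_, fun n R v _ => Iff.rfl⟩
    rintro (x | ⟨⟨⟩⟩) (y | ⟨⟨⟩⟩) h
    exact congrArg _ h
  | @h_option Y _ ih =>
    intro q
    obtain ⟨E, hE, h, hinj, hrel⟩ := ih (q ∘ some)
    set c := q none with hc
    set d := h (Sum.inl c) with hd
    let S : L.Structure {x : E // x ≠ d} := pullbackStructure Subtype.val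
    let A : Bundled.{w} L.Structure := ⟨{x : E // x ≠ d}, S⟩
    have hA : A ∈ K := pullback_mem hK hE _ Subtype.val_injective
    let e : A ↪[L] E := embeddingOfRel (M := {x : E // x ≠ d}) Subtype.val Subtype.val_injective
      fun _ _ _ => Iff.rfl
    obtain ⟨E', hE', f₁, f₂, hcomm, hrange⟩ := hK.2.2.2 A hA E hE E hE e e
    have hf : ∀ x, x ≠ d → f₁ x = f₂ x := fun x hx => DFunLike.congr_fun hcomm (⟨x, hx⟩ : A)
    have hnew : ∀ x, f₁ x ≠ f₂ d := by
      intro x hx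
      have : f₂ d ∈ Set.range ⇑(f₁.comp e) := hrange ▸ ⟨⟨x, hx⟩, ⟨d, rfl⟩⟩
      rw [hcomm] at this
      obtain ⟨a, ha⟩ := this
      exact a.2 (f₂.injective ha)
    let collapse : C ⊕ Option Y → C ⊕ Y :=
      Sum.elim Sum.inl fun o => o.elim (Sum.inl c) Sum.inr
    let h' : C ⊕ Option Y → E' :=
      Sum.elim (fun x => f₁ (h (Sum.inl x))) fun o => o.elim (f₂ d) fun y => f₁ (h (Sum.inr y))
    have hp : Sum.elim id (q ∘ some) ∘ collapse = Sum.elim (id : C → C) q := by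
      ext (x | _ | y) <;> rfl
    have h'₁ : ∀ x, x ≠ Sum.inr none → h' x = f₁ (h (collapse x)) := by
      rintro (x | _ | y) hx
      · rfl
      · exact absurd rfl hx
      · rfl
    have h'₂ : ∀ x, x ≠ Sum.inl c → h' x = f₂ (h (collapse x)) := by
      rintro (x | _ | y) hx
      · exact hf _ fun hxd => hx (by rw [Sum.inl_injective (hinj hxd)])
      · rfl
      · exact hf _ fun hxd => by simpa using hinj hxd
    refine ⟨E', hE', h', ?_, fun n R v hv => ?_⟩
    · rintro (x | _ | x) (y | _ | y) hxy
      · exact congrArg _ (Sum.inl_injective (hinj (f₁.injective hxy)))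
      · exact absurd hxy (hnew _)
      · simpa using hinj (f₁.injective hxy)
      · exact absurd hxy.symm (hnew _)
      · rfl
      · exact absurd hxy.symm (hnew _)
      · simpa using hinj (f₁.injective hxy)
      · exact absurd hxy (hnew _)
      · simpa using hinj (f₁.injective hxy)
    · have key := hrel n R (collapse ∘ v) fun i j hij =>
        congrArg collapse (hv i j (by rw [← hp]; exact hij))
      rw [← Function.comp_assoc (Sum.elim id _), hp] at key
      rw [← key]
      by_cases hn : ∃ i, v i = Sum.inr none
      · obtain ⟨i, hi⟩ := hn
        have : h' ∘ v = f₂ ∘ (h ∘ collapse ∘ v) := funext fun j => h'₂ _ fun hj => by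
          have := hv i j (by rw [hi, hj]; rfl)
          simp [hi, hj] at this
        rw [this, f₂.map_rel]
      · push Not at hn
        have : h' ∘ v = f₁ ∘ (h ∘ collapse ∘ v) := funext fun j => h'₁ _ (hn j)
        rw [this, f₁.map_rel]

/-- For every `p : X → C` with `C` in a strong amalgamation class, there is a structure on `X`
in the class for which `p` preserves and reflects relations on all tuples that are partial
sections of `p`. -/
theorem exists_blowup {K : Set (Bundled.{w} L.Structure)}
    (hK : IsStrongAmalgamationClass K) {C : Bundled.{w} L.Structure} (hC : C ∈ K)
    {X : Type w} [Finite X] (p : X → C) :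
    ∃ S : L.Structure X, (⟨X, S⟩ : Bundled.{w} L.Structure) ∈ K ∧
      ∀ (n : ℕ) (R : L.Relations n) (v : Fin n → X),
        (∀ i j, p (v i) = p (v j) → v i = v j) → (S.RelMap R v ↔ RelMap R (p ∘ v)) := by
  obtain ⟨E, hE, h, hinj, hrel⟩ := exists_duplication hK hC X p
  exact ⟨pullbackStructure (h ∘ Sum.inr), pullback_mem hK hE _ (hinj.comp Sum.inr_injective),
    fun n R v hv => hrel n R (Sum.inr ∘ v) fun i j hij => congrArg Sum.inr (hv i j hij)⟩

end Relational

/-- Ramsey classes satisfy the arrow relation for every finite set of colours. -/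
theorem IsRamseyClass.exists_monochromatic {L : FirstOrder.Language.{u, v}}
    {K : Set (Bundled.{w} L.Structure)} (hr : IsRamseyClass K) {A B : Bundled.{w} L.Structure}
    (hA : A ∈ K) (hB : B ∈ K) (κ : Type*) [Finite κ] :
    ∃ C ∈ K, ∀ χ : (A ↪[L] C) → κ, ∃ g : B ↪[L] C,
      ∀ f₁ f₂ : A ↪[L] B, χ (g.comp f₁) = χ (g.comp f₂) := by
  obtain ⟨n, ⟨e⟩⟩ := Finite.exists_equiv_fin κ
  obtain ⟨C, hC, h⟩ := hr A hA B hB n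
  refine ⟨C, hC, fun χ => ?_⟩
  obtain ⟨g, hg⟩ := h (e ∘ χ)
  exact ⟨g, fun f₁ f₂ => e.injective (hg f₁ f₂)⟩

/-- The product Ramsey theorem for two Ramsey classes. -/
theorem exists_product_monochromatic {σ : FirstOrder.Language.{u, v}}
    {τ : FirstOrder.Language.{u', v'}} {K₁ : Set (Bundled.{w} σ.Structure)}
    {K₂ : Set (Bundled.{w} τ.Structure)} (hfin : ∀ A ∈ K₂, Finite A)
    (hr₁ : IsRamseyClass K₁) (hr₂ : IsRamseyClass K₂)
    {A₁ B₁ : Bundled.{w} σ.Structure} (hA₁ : A₁ ∈ K₁) (hB₁ : B₁ ∈ K₁)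
    {A₂ B₂ : Bundled.{w} τ.Structure} (hA₂ : A₂ ∈ K₂) (hB₂ : B₂ ∈ K₂)
    (f₀ : A₁ ↪[σ] B₁) (r : ℕ) :
    ∃ C₁ ∈ K₁, ∃ C₂ ∈ K₂, ∀ χ : (A₁ ↪[σ] C₁) → (A₂ ↪[τ] C₂) → Fin r,
      ∃ g₁ : B₁ ↪[σ] C₁, ∃ g₂ : B₂ ↪[τ] C₂, ∀ (f₁ f₁' : A₁ ↪[σ] B₁) (f₂ f₂' : A₂ ↪[τ] B₂),
        χ (g₁.comp f₁) (g₂.comp f₂) = χ (g₁.comp f₁') (g₂.comp f₂') := by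
  obtain ⟨C₂, hC₂, h₂⟩ := hr₂ A₂ hA₂ B₂ hB₂ r
  have := hfin A₂ hA₂
  have := hfin C₂ hC₂
  have : Finite (A₂ ↪[τ] C₂) := DFunLike.finite _
  obtain ⟨C₁, hC₁, h₁⟩ := hr₁.exists_monochromatic hA₁ hB₁ ((A₂ ↪[τ] C₂) → Fin r)
  refine ⟨C₁, hC₁, C₂, hC₂, fun χ => ?_⟩
  obtain ⟨g₁, hg₁⟩ := h₁ χ
  obtain ⟨g₂, hg₂⟩ := h₂ (χ (g₁.comp f₀))
  refine ⟨g₁, g₂, fun f₁ f₁' f₂ f₂' => ?_⟩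
  rw [hg₁ f₁ f₀, hg₁ f₁' f₀, hg₂ f₂ f₂']

section Reducts

variable {σ : FirstOrder.Language.{u, v}} {τ : FirstOrder.Language.{u', v'}}
  {A B : Bundled.{w} (σ.sum τ).Structure}

/-- An embedding of `(σ ∪ τ)`-structures as an embedding of the `σ`-reducts. -/
def reductEmbedding₁ (f : A ↪[σ.sum τ] B) : sumReduct₁ A ↪[σ] sumReduct₁ B where
  toFun := f
  inj' := f.injective
  map_fun' F v := f.map_fun (Sum.inl F : (σ.sum τ).Functions _) v
  map_rel' R v := f.map_rel (Sum.inl R : (σ.sum τ).Relations _) v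

/-- An embedding of `(σ ∪ τ)`-structures as an embedding of the `τ`-reducts. -/
def reductEmbedding₂ (f : A ↪[σ.sum τ] B) : sumReduct₂ A ↪[τ] sumReduct₂ B where
  toFun := f
  inj' := f.injective
  map_fun' F v := f.map_fun (Sum.inr F : (σ.sum τ).Functions _) v
  map_rel' R v := f.map_rel (Sum.inr R : (σ.sum τ).Relations _) v

end Reducts

/-- **New Ramsey classes from old.** If `𝒞₁` and `𝒞₂` are strong amalgamation classes of
finite structures with the Ramsey property, in disjoint finite relational signatures `σ`
and `τ`, then `𝒞₁ ∧ 𝒞₂` is also Ramsey. -/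
theorem statement0 (σ : FirstOrder.Language.{u, v}) (τ : FirstOrder.Language.{u', v'})
    [σ.IsRelational] [τ.IsRelational] [Finite σ.Symbols] [Finite τ.Symbols]
    (K₁ : Set (Bundled.{w} σ.Structure)) (K₂ : Set (Bundled.{w} τ.Structure))
    (h₁ : IsStrongAmalgamationClass K₁) (h₂ : IsStrongAmalgamationClass K₂)
    (hr₁ : IsRamseyClass K₁) (hr₂ : IsRamseyClass K₂) :
    IsRamseyClass (AndClass K₁ K₂) := by
  intro A hA B hB r
  rcases isEmpty_or_nonempty (A ↪[σ.sum τ] B) with hAB | ⟨⟨f₀⟩⟩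
  · exact ⟨B, hB, fun _ => ⟨Embedding.refl _ _, fun f => isEmptyElim f⟩⟩
  obtain ⟨C₁, hC₁, C₂, hC₂, hC⟩ := exists_product_monochromatic h₂.1 hr₁ hr₂ hA.1 hB.1 hA.2 hB.2
    (reductEmbedding₁ f₀) r
  have := h₁.1 C₁ hC₁
  have := h₂.1 C₂ hC₂
  obtain ⟨S₁, hS₁, hrel₁⟩ := exists_blowup h₁ hC₁ (Prod.fst : C₁ × C₂ → C₁)
  obtain ⟨S₂, hS₂, hrel₂⟩ := exists_blowup h₂ hC₂ (Prod.snd : C₁ × C₂ → C₂)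
  let D : Bundled.{w} (σ.sum τ).Structure := ⟨C₁ × C₂, sumStructure σ τ (C₁ × C₂)⟩
  have hD : D ∈ AndClass K₁ K₂ := ⟨hS₁, hS₂⟩
  let pair {M : Bundled.{w} (σ.sum τ).Structure} (f₁ : sumReduct₁ M ↪[σ] C₁)
      (f₂ : sumReduct₂ M ↪[τ] C₂) : M ↪[σ.sum τ] D :=
    embeddingOfRel (fun x : M => ((f₁ x, f₂ x) : C₁ × C₂))
      (fun x y hxy => f₁.injective (congrArg Prod.fst hxy)) fun n R v => by
        rcases R with R | R
        · exact (hrel₁ n R _ fun i j hij => by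
            have : v i = v j := f₁.injective hij
            simp [this]).trans (f₁.map_rel R v)
        · exact (hrel₂ n R _ fun i j hij => by
            have : v i = v j := f₂.injective hij
            simp [this]).trans (f₂.map_rel R v)
  refine ⟨D, hD, fun χ => ?_⟩
  obtain ⟨g₁, g₂, hg⟩ := hC fun f₁ f₂ => χ (pair f₁ f₂)
  exact ⟨pair g₁ g₂, fun f f' => hg (reductEmbedding₁ f) (reductEmbedding₁ f')
    (reductEmbedding₂ f) (reductEmbedding₂ f')⟩
end

section
/- Let σ, τ, and {<} be pairwise disjoint relational signatures, let ℒ𝒪 be the class of all finite strict linear orders (as {<}-structures), let 𝒞₁ be a class of finite σ-structures and 𝒞₂ a class of finite τ-structures such that 𝒞₁ and ℒ𝒪 ∧ 𝒞₂ are both Ramsey classes with strong amalgamation and ω-categorical Fraïssé limits. Then 𝒞₁ ∧ 𝒞₂ has the Ramsey property. -/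
open FirstOrder FirstOrder.Language CategoryTheory

universe u v u' v' w

/-- A structure `M` is ω-categorical if its complete first-order theory has exactly one
countably infinite model up to isomorphism. -/
def IsOmegaCategorical (L : FirstOrder.Language.{u, v}) (M : Type w) [L.Structure M] : Prop :=
  ∃ N : Theory.ModelType.{u, v, w} (L.completeTheory M), Countable N ∧ Infinite N ∧
    ∀ N' : Theory.ModelType.{u, v, w} (L.completeTheory M),
      Countable N' → Infinite N' → Nonempty (N' ≃[L] N)

/-- `M` is the Fraïssé limit of the class `K`: a countable ultrahomogeneous structure whose
age (the class of finite structures embedding into it) is exactly `K`. -/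
def IsFraisseLimitOf {L : FirstOrder.Language.{u, v}} (K : Set (Bundled.{w} L.Structure)) (M : Type w)
    [L.Structure M] : Prop :=
  Countable M ∧ L.IsUltrahomogeneous M ∧
    ∀ A : Bundled.{w} L.Structure, A ∈ K ↔ (Finite A ∧ Nonempty (A ↪[L] M))

/-- The class `K` has an ω-categorical Fraïssé limit. -/
def HasOmegaCatFraisseLimit {L : FirstOrder.Language.{u, v}} (K : Set (Bundled.{w} L.Structure)) : Prop :=
  ∃ (M : Type w) (s : L.Structure M),
    @IsFraisseLimitOf L K M s ∧ @IsOmegaCategorical L M s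

/-- The class `ℒ𝒪` of all finite strict linear orders, as structures over the signature with
a single binary relation symbol. -/
def LOClass : Set (Bundled.{w} FirstOrder.Language.order.Structure) :=
  {A | Finite A ∧
    IsStrictTotalOrder A (fun x y : A =>
      Structure.RelMap (leSymb : FirstOrder.Language.order.Relations 2) ![x, y])}

section Embeddings

variable {L : FirstOrder.Language.{u, v}}

/-- In a relational language, an injection preserving and reflecting relations is an embedding. -/
def embeddingOfRelational [L.IsRelational] {M N : Type*} [L.Structure M] [L.Structure N]
    (f : M → N) (hf : Function.Injective f)
    (h : ∀ {n} (R : L.Relations n) (x : Fin n → M),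
      Structure.RelMap R (f ∘ x) ↔ Structure.RelMap R x) : M ↪[L] N where
  toFun := f
  inj' := hf
  map_fun' F := isEmptyElim F
  map_rel' := h

/-- The structure on `X` making `f : X → M` preserve and reflect all relations. -/
@[reducible]
def comapStructure [L.IsRelational] {X M : Type*} [L.Structure M] (f : X → M) : L.Structure X where
  funMap F := isEmptyElim F
  RelMap R x := Structure.RelMap R (f ∘ x)

variable {σ : FirstOrder.Language.{u, v}} {τ : FirstOrder.Language.{u', v'}}

/-- An embedding is an embedding of the first reducts. -/
def sumReduct₁Embedding {A B : Bundled.{w} (σ.sum τ).Structure} (f : A ↪[σ.sum τ] B) :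
    sumReduct₁ A ↪[σ] sumReduct₁ B where
  toFun := f
  inj' := f.injective
  map_fun' F x := f.map_fun (Sum.inl F : (σ.sum τ).Functions _) x
  map_rel' R x := f.map_rel (Sum.inl R : (σ.sum τ).Relations _) x

/-- An embedding is an embedding of the second reducts. -/
def sumReduct₂Embedding {A B : Bundled.{w} (σ.sum τ).Structure} (f : A ↪[σ.sum τ] B) :
    sumReduct₂ A ↪[τ] sumReduct₂ B where
  toFun := f
  inj' := f.injective
  map_fun' F x := f.map_fun (Sum.inr F : (σ.sum τ).Functions _) x
  map_rel' R x := f.map_rel (Sum.inr R : (σ.sum τ).Relations _) x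

/-- A map that is an embedding of both reducts is an embedding. -/
def embeddingOfReducts {A B : Bundled.{w} (σ.sum τ).Structure}
    (f₁ : sumReduct₁ A ↪[σ] sumReduct₁ B) (f₂ : sumReduct₂ A ↪[τ] sumReduct₂ B)
    (h : ∀ x : A, (f₁ x : B) = f₂ x) : A ↪[σ.sum τ] B where
  toFun := f₁
  inj' := f₁.injective
  map_fun' := by
    rintro n (F | F) x
    · exact f₁.map_fun F x
    · have h' : (f₁ : A → B) = f₂ := funext h
      change (f₁ : A → B) _ = Structure.funMap (M := B) _ ((f₁ : A → B) ∘ x)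
      rw [h']
      exact f₂.map_fun F x
  map_rel' := by
    rintro n (R | R) x
    · exact f₁.map_rel R x
    · have h' : (f₁ : A → B) = f₂ := funext h
      change Structure.RelMap (M := B) _ ((f₁ : A → B) ∘ x) ↔ _
      rw [h']
      exact f₂.map_rel R x

end Embeddings

section BlowUp

variable {L : FirstOrder.Language.{u, v}} [L.IsRelational] {K : Set (Bundled.{w} L.Structure)}

/-- Strong amalgamation of a structure with itself over the complement of a set `S`: two copies
that agree outside `S` and have no common points otherwise. -/
theorem IsStrongAmalgamationClass.exists_double (hK : IsStrongAmalgamationClass K)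
    {D : Bundled.{w} L.Structure} (hD : D ∈ K) (S : Set D) :
    ∃ E ∈ K, ∃ g₀ g₁ : D ↪[L] E, (∀ x ∉ S, g₀ x = g₁ x) ∧
      ∀ x ∈ S, ∀ y, g₁ x ≠ g₀ y := by
  obtain ⟨hfin, hher, -, hamalg⟩ := hK
  have := hfin D hD
  let s : L.Structure {x : D // x ∉ S} := comapStructure Subtype.val
  let e : {x : D // x ∉ S} ↪[L] D := embeddingOfRelational Subtype.val
    Subtype.val_injective fun _ _ => Iff.rfl
  have hA : ⟨{x : D // x ∉ S}, s⟩ ∈ K :=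
    hher D hD ⟨_, s⟩ (inferInstanceAs (Finite {x // x ∉ S})) ⟨e⟩
  obtain ⟨E, hE, g₀, g₁, hcomp, hrange⟩ := hamalg _ hA D hD D hD e e
  refine ⟨E, hE, g₀, g₁, fun x hx => DFunLike.congr_fun hcomp (⟨x, hx⟩ : {x : D // x ∉ S}), ?_⟩
  intro x hx y hxy
  have hmem : g₁ x ∈ Set.range g₀ ∩ Set.range g₁ := ⟨⟨y, hxy.symm⟩, ⟨x, rfl⟩⟩
  rw [hrange, hcomp] at hmem
  obtain ⟨a, ha⟩ := hmem
  have hax : e a = x := g₁.injective ha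
  exact a.2 (by rw [← hax] at hx; exact hx)

/-- Auxiliary form of `IsStrongAmalgamationClass.exists_blowUp`, in which the points of `T` have
already been separated from all others. -/
theorem IsStrongAmalgamationClass.exists_partial_blowUp (hK : IsStrongAmalgamationClass K)
    {C : Bundled.{w} L.Structure} (hC : C ∈ K) {P : Type w} (p : P → C) (T : Finset P) :
    ∃ D ∈ K, ∃ d : P → D,
      (∀ z z', d z = d z' → z = z' ∨ (p z = p z' ∧ z ∉ T ∧ z' ∉ T)) ∧
      ∀ (X : Bundled.{w} L.Structure) (f : X ↪[L] C) (g : X → P), (∀ x, p (g x) = f x) →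
        ∃ e : X ↪[L] D, ∀ x, e x = d (g x) := by
  classical
  induction T using Finset.induction_on with
  | empty =>
    exact ⟨C, hC, p, fun z z' h => Or.inr ⟨h, by simp⟩,
      fun X f g h => ⟨f, fun x => (h x).symm⟩⟩
  | insert y T _ ih =>
    obtain ⟨D, hD, d, hd, hemb⟩ := ih
    obtain ⟨E, hE, g₀, g₁, hagree, hne⟩ := hK.exists_double hD {a | ∃ z, p z = p y ∧ d z = a}
    have hy : ∀ a, g₁ (d y) ≠ g₀ a := hne _ ⟨y, rfl, rfl⟩
    refine ⟨E, hE, fun z => if z = y then g₁ (d y) else g₀ (d z), ?_, ?_⟩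
    · intro z z' h
      by_cases hz : z = y <;> by_cases hz' : z' = y <;> simp only [hz, hz', if_true, if_false] at h
      · exact Or.inl (hz.trans hz'.symm)
      · exact absurd h (hy _)
      · exact absurd h.symm (hy _)
      · refine (hd z z' (g₀.injective h)).imp_right ?_
        simp [hz, hz']
    · intro X f g hfg
      obtain ⟨e, he⟩ := hemb X f g hfg
      by_cases hr : ∃ x, g x = y
      · obtain ⟨x₀, rfl⟩ := hr
        refine ⟨g₁.comp e, fun x => ?_⟩
        rw [Embedding.comp_apply, he]
        beta_reduce
        split_ifs with hx
        · rw [hx]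
        · refine (hagree _ ?_).symm
          rintro ⟨z, hz, hdz⟩
          have hp : p (g x) = p (g x₀) := by
            rcases hd _ _ hdz with h | h
            · rw [← h, hz]
            · rw [← h.1, hz]
          rw [hfg, hfg] at hp
          exact hx (congrArg g (f.injective hp))
      · refine ⟨g₀.comp e, fun x => ?_⟩
        exact (congrArg g₀ (he x)).trans (if_neg fun h => hr ⟨x, h⟩).symm

/-- In a strong amalgamation class, the points of a member `C` can be multiplied according to any
map `p : P → C` in such a way that every lift to `P` of an embedding into `C` is an embedding. -/
theorem IsStrongAmalgamationClass.exists_blowUp (hK : IsStrongAmalgamationClass K)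
    {C : Bundled.{w} L.Structure} (hC : C ∈ K) {P : Type w} [Finite P] (p : P → C) :
    ∃ s : L.Structure P, (⟨P, s⟩ : Bundled.{w} L.Structure) ∈ K ∧
      ∀ (X : Bundled.{w} L.Structure) (f : X ↪[L] C) (g : X → P), (∀ x, p (g x) = f x) →
        ∃ e : X ↪[L] P, ∀ x, e x = g x := by
  have := Fintype.ofFinite P
  obtain ⟨D, hD, d, hd, hemb⟩ := hK.exists_partial_blowUp hC p Finset.univ
  have hinj : Function.Injective d := fun z z' h => by simpa using hd z z' h
  let s : L.Structure P := comapStructure d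
  refine ⟨s, hK.2.1 D hD _ ‹_›
    ⟨embeddingOfRelational d hinj fun _ _ => Iff.rfl⟩, fun X f g hfg => ?_⟩
  obtain ⟨e, he⟩ := hemb X f g hfg
  have hcomp : d ∘ g = e := funext fun x => (he x).symm
  refine ⟨embeddingOfRelational g ?_ fun R x => ?_, fun _ => rfl⟩
  · exact Function.Injective.of_comp (f := d) (hcomp ▸ e.injective)
  · change Structure.RelMap R (d ∘ g ∘ x) ↔ _
    rw [← Function.comp_assoc, hcomp]
    exact e.map_rel R x

end BlowUp

section Ramsey

variable {L : FirstOrder.Language.{u, v}} {K : Set (Bundled.{w} L.Structure)}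

/-- The Ramsey property for colourings with values in an arbitrary finite type. -/
theorem IsRamseyClass.exists_of_finite (hK : IsRamseyClass K) {A B : Bundled.{w} L.Structure}
    (hA : A ∈ K) (hB : B ∈ K) (κ : Type*) [Finite κ] :
    ∃ C ∈ K, ∀ χ : (A ↪[L] C) → κ, ∃ g : B ↪[L] C,
      ∀ f₁ f₂ : A ↪[L] B, χ (g.comp f₁) = χ (g.comp f₂) := by
  obtain ⟨C, hC, h⟩ := hK A hA B hB (Nat.card κ)
  refine ⟨C, hC, fun χ => ?_⟩
  obtain ⟨g, hg⟩ := h (Finite.equivFin κ ∘ χ)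
  exact ⟨g, fun f₁ f₂ => (Finite.equivFin κ).injective (hg f₁ f₂)⟩

/-- Members of a Ramsey class of finite structures can be ordered so that all embeddings between
two given ones are monotone. -/
theorem IsRamseyClass.exists_orders (hK : IsRamseyClass K) {A B : Bundled.{w} L.Structure}
    (hA : A ∈ K) (hB : B ∈ K) [Finite A] :
    ∃ (rA : A → A → Prop) (rB : B → B → Prop), IsStrictTotalOrder A rA ∧
      IsStrictTotalOrder B rB ∧ ∀ (f : A ↪[L] B) (x y : A), rB (f x) (f y) ↔ rA x y := by
  obtain ⟨C, -, hC⟩ := hK.exists_of_finite hA hB (A → A → Prop)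
  obtain ⟨g, hg⟩ := hC fun f x y => WellOrderingRel (f x) (f y)
  have hpre {M : Type w} (f : M ↪ C) :
      IsStrictTotalOrder M fun x y => WellOrderingRel (f x) (f y) :=
    (RelEmbedding.preimage f WellOrderingRel).isStrictTotalOrder
  rcases isEmpty_or_nonempty (A ↪[L] B) with h | ⟨⟨f₀⟩⟩
  · exact ⟨WellOrderingRel, _, inferInstance, hpre g.toEmbedding, fun f => h.elim f⟩
  · refine ⟨_, _, hpre (g.comp f₀).toEmbedding, hpre g.toEmbedding, fun f x y => ?_⟩
    exact iff_of_eq (congrFun (congrFun (hg f f₀) x) y)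

end Ramsey

section OrderExpansion

variable {σ : FirstOrder.Language.{u, v}} {τ : FirstOrder.Language.{u', v'}}

/-- The `τ`-reduct of `A` expanded by the binary relation `r`. -/
def orderExpansion (A : Bundled.{w} (σ.sum τ).Structure) (r : A → A → Prop) :
    Bundled.{w} (FirstOrder.Language.order.sum τ).Structure :=
  ⟨A.α, @Language.sumStructure _ τ A.α (@orderStructure A.α ⟨r⟩) (sumReduct₂ A).str⟩

theorem orderExpansion_mem {A : Bundled.{w} (σ.sum τ).Structure} {r : A → A → Prop}
    {K : Set (Bundled.{w} τ.Structure)} [Finite A] (hr : IsStrictTotalOrder A r)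
    (hA : sumReduct₂ A ∈ K) : orderExpansion A r ∈ AndClass LOClass K :=
  ⟨⟨‹_›, hr⟩, hA⟩

/-- A monotone embedding is an embedding of the ordered expansions. -/
def orderExpansionEmbedding [τ.IsRelational] {A B : Bundled.{w} (σ.sum τ).Structure}
    {rA : A → A → Prop} {rB : B → B → Prop} (f : A ↪[σ.sum τ] B)
    (hf : ∀ x y, rB (f x) (f y) ↔ rA x y) :
    orderExpansion A rA ↪[FirstOrder.Language.order.sum τ] orderExpansion B rB :=
  embeddingOfRelational (M := orderExpansion A rA) (N := orderExpansion B rB) f f.injective <| by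
    rintro n (R | R) x
    · cases R
      exact hf (x 0) (x 1)
    · exact f.map_rel (Sum.inr R : (σ.sum τ).Relations _) x

end OrderExpansion

/-- **Forgetting one order.** If `𝒞₁` and `ℒ𝒪 ∧ 𝒞₂` are Ramsey classes with strong
amalgamation and ω-categorical Fraïssé limits (the signatures of `𝒞₁`, `𝒞₂` and `ℒ𝒪` being
pairwise disjoint), then `𝒞₁ ∧ 𝒞₂` has the Ramsey property. -/
theorem statement2 (σ : FirstOrder.Language.{u, v}) (τ : FirstOrder.Language.{u', v'})
    [σ.IsRelational] [τ.IsRelational]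
    (K₁ : Set (Bundled.{w} σ.Structure)) (K₂ : Set (Bundled.{w} τ.Structure))
    (h₁sac : IsStrongAmalgamationClass K₁)
    (h₁ram : IsRamseyClass K₁)
    (h₁lim : HasOmegaCatFraisseLimit K₁)
    (h₂sac : IsStrongAmalgamationClass (AndClass LOClass K₂))
    (h₂ram : IsRamseyClass (AndClass LOClass K₂))
    (h₂lim : HasOmegaCatFraisseLimit (AndClass LOClass K₂)) :
    IsRamseyClass (AndClass K₁ K₂) := by
  intro A hA B hB r
  have hAfin : Finite A := h₁sac.1 _ hA.1
  have hBfin : Finite B := h₁sac.1 _ hB.1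
  obtain ⟨rA, rB, hrA, hrB, hmono⟩ : ∃ (rA : A → A → Prop) (rB : B → B → Prop),
      IsStrictTotalOrder A rA ∧ IsStrictTotalOrder B rB ∧
      ∀ (f : sumReduct₁ A ↪[σ] sumReduct₁ B) (x y : A), rB (f x) (f y) ↔ rA x y :=
    have : Finite (sumReduct₁ A) := hAfin
    h₁ram.exists_orders hA.1 hB.1
  have hA₂ : orderExpansion A rA ∈ AndClass LOClass K₂ := orderExpansion_mem hrA hA.2
  have hB₂ : orderExpansion B rB ∈ AndClass LOClass K₂ := orderExpansion_mem hrB hB.2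
  -- The extra colour makes constant colourings available also for `r = 0`.
  obtain ⟨C₁, hC₁, hram₁⟩ := h₁ram.exists_of_finite hA.1 hB.1 (Option (Fin r))
  have hC₁fin : Finite C₁ := h₁sac.1 _ hC₁
  have : Finite (sumReduct₁ A ↪[σ] C₁) :=
    have : Finite (sumReduct₁ A) := hAfin
    Finite.of_injective _ (DFunLike.coe_injective (F := sumReduct₁ A ↪[σ] C₁))
  obtain ⟨C₂, hC₂, hram₂⟩ := h₂ram.exists_of_finite hA₂ hB₂
    ((sumReduct₁ A ↪[σ] C₁) → Option (Fin r))
  have hC₂fin : Finite C₂ := h₂sac.1 _ hC₂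
  obtain ⟨s₁, hs₁, hlift₁⟩ := h₁sac.exists_blowUp hC₁ (Prod.fst : C₁ × C₂ → C₁)
  obtain ⟨s₂, hs₂, hlift₂⟩ := h₂sac.exists_blowUp hC₂ (Prod.snd : C₁ × C₂ → C₂)
  let E : Bundled.{w} (FirstOrder.Language.order.sum τ).Structure := ⟨C₁ × C₂, s₂⟩
  let s : (σ.sum τ).Structure (C₁ × C₂) := @Language.sumStructure σ τ _ s₁ (sumReduct₂ E).str
  have hpair (X : Bundled.{w} (σ.sum τ).Structure) (rX : X → X → Prop)
      (f₁ : sumReduct₁ X ↪[σ] C₁)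
      (f₂ : orderExpansion X rX ↪[FirstOrder.Language.order.sum τ] C₂) :
      ∃ f : X ↪[σ.sum τ] (C₁ × C₂), ∀ x : X, f x = (f₁ x, f₂ x) := by
    obtain ⟨e₁, he₁⟩ := hlift₁ (sumReduct₁ X) f₁ (fun x => (f₁ x, f₂ x)) fun _ => rfl
    obtain ⟨e₂, he₂⟩ := hlift₂ (orderExpansion X rX) f₂ (fun x => (f₁ x, f₂ x)) fun _ => rfl
    exact ⟨embeddingOfReducts (A := X) (B := ⟨C₁ × C₂, s⟩) e₁
      (sumReduct₂Embedding (A := orderExpansion X rX) (B := E) e₂)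
      fun x => (he₁ x).trans (he₂ x).symm, he₁⟩
  refine ⟨⟨C₁ × C₂, s⟩, ⟨hs₁, hs₂.2⟩, fun χ => ?_⟩
  choose φ hφ using hpair A rA
  obtain ⟨g₂, hg₂⟩ := hram₂ fun f₂ f₁ => some (χ (φ f₁ f₂))
  obtain ⟨g₁, hg₁⟩ : ∃ g₁ : sumReduct₁ B ↪[σ] C₁,
      ∀ (f f' : sumReduct₁ A ↪[σ] sumReduct₁ B)
        (k : orderExpansion A rA ↪[FirstOrder.Language.order.sum τ] orderExpansion B rB),
        χ (φ (g₁.comp f) (g₂.comp k)) = χ (φ (g₁.comp f') (g₂.comp k)) := by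
    rcases isEmpty_or_nonempty
      (orderExpansion A rA ↪[FirstOrder.Language.order.sum τ] orderExpansion B rB) with h | ⟨⟨k₀⟩⟩
    · obtain ⟨g₁, -⟩ := hram₁ fun _ => none
      exact ⟨g₁, fun _ _ k => h.elim k⟩
    · obtain ⟨g₁, hg₁⟩ := hram₁ fun f₁ => some (χ (φ f₁ (g₂.comp k₀)))
      refine ⟨g₁, fun f f' k => ?_⟩
      have hk (f₁) : χ (φ f₁ (g₂.comp k)) = χ (φ f₁ (g₂.comp k₀)) :=
        Option.some_injective _ (congrFun (hg₂ k k₀) f₁)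
      rw [hk, hk]
      exact Option.some_injective _ (hg₁ f f')
  obtain ⟨g, hg⟩ := hpair B rB g₁ g₂
  have hcomp (f : A ↪[σ.sum τ] B) : g.comp f = φ (g₁.comp (sumReduct₁Embedding f))
      (g₂.comp (orderExpansionEmbedding f (hmono (sumReduct₁Embedding f)))) :=
    DFunLike.ext _ _ fun x => (hg (f x)).trans (hφ (g₁.comp (sumReduct₁Embedding f))
      (g₂.comp (orderExpansionEmbedding f (hmono (sumReduct₁Embedding f)))) x).symm
  refine ⟨g, fun f f' => ?_⟩
  rw [hcomp, hcomp, hg₁ _ (sumReduct₁Embedding f')]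
  exact Option.some_injective _ (congrFun (hg₂ _ _) _)
end

section
/- The class of all finite sets equipped with two strict linear orders (<₁, <₂) has the Ramsey property: for all finite structures A, B of this kind and all r ∈ ℕ, there exists a finite set C with two strict linear orders such that for every coloring χ : Emb(A,C) → Fin r there is g ∈ Emb(B,C) with χ constant on {g ∘ f : f ∈ Emb(A,B)}. -/
/-- A relational structure with binary relations indexed by `ι`. -/
structure BinStr (ι : Type) : Type 1 where
  carrier : Type
  rel : ι → carrier → carrier → Prop

/-- An embedding of such structures: an injective map that preserves and reflects
each of the relations. -/
structure BinEmb {ι : Type} (A B : BinStr ι) : Type where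
  toFun : A.carrier → B.carrier
  inj : Function.Injective toFun
  map_rel : ∀ (i : ι) (x y : A.carrier), A.rel i x y ↔ B.rel i (toFun x) (toFun y)

/-- Composition of embeddings. -/
def BinEmb.comp {ι : Type} {A B C : BinStr ι} (g : BinEmb B C) (f : BinEmb A B) :
    BinEmb A C where
  toFun := g.toFun ∘ f.toFun
  inj := g.inj.comp f.inj
  map_rel i x y := (f.map_rel i x y).trans (g.map_rel i (f.toFun x) (f.toFun y))

/-- The Ramsey property for a class of structures: for all `A, B` in the class and all
`r : ℕ` there is `C` in the class such that every colouring of the embeddings of `A` into `C`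
with `r` colours is constant on the copies of `A` inside some copy of `B` in `C`. -/
def BinRamseyClass {ι : Type} (K : Set (BinStr ι)) : Prop :=
  ∀ A ∈ K, ∀ B ∈ K, ∀ r : ℕ, ∃ C ∈ K,
    ∀ χ : BinEmb A C → Fin r, ∃ g : BinEmb B C,
      ∀ f₁ f₂ : BinEmb A B, χ (g.comp f₁) = χ (g.comp f₂)

/-- The finite **Ramsey theorem** for colourings of the `k`-element subsets of a linearly ordered
set: every sufficiently large finite set contains an `m`-element homogeneous subset. -/
theorem exists_homogeneous_finset (k : ℕ) : ∀ (κ : Type) [Finite κ] (m : ℕ), ∃ N : ℕ,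
    ∀ (α : Type) [LinearOrder α] (S : Finset α), N ≤ S.card → ∀ c : Finset α → κ,
      ∃ T ⊆ S, T.card = m ∧ ∃ a, ∀ U ⊆ T, U.card = k → c U = a := by
  induction k with
  | zero =>
    intro κ _ m
    refine ⟨m, fun α _ S hS c => ?_⟩
    obtain ⟨T, hTS, hT⟩ := Finset.exists_subset_card_eq hS
    exact ⟨T, hTS, hT, c ∅, fun U _ hU => by rw [Finset.card_eq_zero.1 hU]⟩
  | succ k ih =>
    intro κ _ m
    classical
    have endHomogeneous : ∀ n : ℕ, ∃ N : ℕ, ∀ (α : Type) [LinearOrder α] (S : Finset α),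
        N ≤ S.card → ∀ c : Finset α → κ, ∃ T ⊆ S, T.card = n ∧ ∃ d : α → κ,
          ∀ x ∈ T, ∀ U ⊆ T, U.card = k → (∀ y ∈ U, x < y) → c (insert x U) = d x := by
      intro n
      induction n with
      | zero =>
        exact ⟨0, fun α _ S _ c => ⟨∅, by simp, rfl, fun _ => c ∅, by simp⟩⟩
      | succ n ihn =>
        obtain ⟨N, hN⟩ := ihn
        obtain ⟨M, hM⟩ := ih κ N
        refine ⟨M + 1, fun α _ S hS c => ?_⟩
        have hne : S.Nonempty := Finset.card_pos.1 (by omega)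
        set x := S.min' hne
        have hxS : x ∈ S := S.min'_mem hne
        obtain ⟨T', hT'S, hT', a, ha⟩ := hM α (S.erase x)
          (by rw [Finset.card_erase_of_mem hxS]; omega) (fun U => c (insert x U))
        obtain ⟨T, hTT', hT, d, hd⟩ := hN α T' hT'.ge c
        have hlt : ∀ y ∈ T, x < y := fun y hy => S.min'_lt_of_mem_erase_min' hne (hT'S (hTT' hy))
        have hxT : x ∉ T := fun h => lt_irrefl x (hlt x h)
        refine ⟨insert x T, ?_, by rw [Finset.card_insert_of_notMem hxT, hT],
          Function.update d x a, ?_⟩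
        · exact Finset.insert_subset hxS ((hTT'.trans hT'S).trans (Finset.erase_subset _ _))
        · intro y hy U hU hUk hyU
          have hUT : U ⊆ T := by
            intro z hz
            refine (Finset.mem_insert.1 (hU hz)).resolve_left ?_
            rintro rfl
            rcases Finset.mem_insert.1 hy with h | h
            · exact (hyU _ hz).ne h
            · exact lt_asymm (hyU _ hz) (hlt y h)
          rcases Finset.mem_insert.1 hy with rfl | hyT
          · rw [Function.update_self]
            exact ha U (hUT.trans hTT') hUk
          · rw [Function.update_of_ne (hlt y hyT).ne']
            exact hd y hyT U hUT hUk hyU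
    have := Fintype.ofFinite κ
    obtain ⟨N, hN⟩ := endHomogeneous (Fintype.card κ * m)
    refine ⟨N, fun α _ S hS c => ?_⟩
    obtain ⟨T, hTS, hT, d, hd⟩ := hN α S hS c
    obtain ⟨a, -, ha⟩ := Finset.exists_le_card_fiber_of_mul_le_card_of_maps_to
      (s := T) (t := Finset.univ) (f := d) (n := m) (fun _ _ => Finset.mem_univ _)
      ⟨c ∅, Finset.mem_univ _⟩ (by rw [hT, Finset.card_univ])
    obtain ⟨T', hT'T, hT'⟩ := Finset.exists_subset_card_eq ha
    have hsub : T' ⊆ T := hT'T.trans (Finset.filter_subset _ _)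
    refine ⟨T', hsub.trans hTS, hT', a, fun U hU hUk => ?_⟩
    have hne : U.Nonempty := Finset.card_pos.1 (by omega)
    have hmem := U.min'_mem hne
    rw [← Finset.insert_erase hmem, hd _ (hsub (hU hmem)) _
      ((Finset.erase_subset _ _).trans (hU.trans hsub))
      (by rw [Finset.card_erase_of_mem hmem, hUk]; rfl)
      (fun y hy => U.min'_lt_of_mem_erase_min' hne hy)]
    exact (Finset.mem_filter.1 (hT'T (hU hmem))).2

/-- Embeddings of a finite strict total order into a linear order are determined by their range. -/
theorem RelEmbedding.eq_of_range_eq {A α : Type*} [Finite A] [LinearOrder α] {r : A → A → Prop}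
    [IsStrictTotalOrder A r] {f g : r ↪r ((· < ·) : α → α → Prop)}
    (h : Set.range f = Set.range g) : f = g := by
  classical
  let := linearOrderOfSTO r
  have hf : StrictMono f := fun _ _ hab => f.map_rel_iff.2 hab
  have hg : StrictMono g := fun _ _ hab => g.map_rel_iff.2 hab
  exact DFunLike.coe_injective ((hf.range_inj hg).1 h)

/-- The class of finite strict total orders has the Ramsey property for embeddings. -/
theorem exists_ramsey_relEmbedding {A B : Type} [Finite A] [Finite B]
    (r : A → A → Prop) (s : B → B → Prop) [IsStrictTotalOrder A r] [IsStrictTotalOrder B s]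
    (κ : Type) [Finite κ] : ∃ N : ℕ, ∀ χ : r ↪r ((· < ·) : Fin N → Fin N → Prop) → κ,
      ∃ g : s ↪r ((· < ·) : Fin N → Fin N → Prop),
        ∀ f₁ f₂ : r ↪r s, χ (f₁.trans g) = χ (f₂.trans g) := by
  classical
  have := Fintype.ofFinite A
  have := Fintype.ofFinite B
  obtain ⟨N, hN⟩ := exists_homogeneous_finset (Fintype.card A) (Set κ) (Fintype.card B)
  refine ⟨N, fun χ => ?_⟩
  obtain ⟨T, -, hT, a, ha⟩ := hN (Fin N) Finset.univ (by simp)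
    (fun U => {x | ∃ f : r ↪r ((· < ·) : Fin N → Fin N → Prop), Set.range f = U ∧ χ f = x})
  let := linearOrderOfSTO s
  let e : B ≃o T := (Fintype.orderIsoFinOfCardEq B rfl).symm.trans (T.orderIsoOfFin hT)
  let g : s ↪r ((· < ·) : Fin N → Fin N → Prop) :=
    OrderEmbedding.ltEmbedding (e.toOrderEmbedding.trans (OrderEmbedding.subtype (· ∈ T)))
  have hgT : ∀ b, g b ∈ T := fun b => (e b).2
  have key : ∀ f : r ↪r s, a = {χ (f.trans g)} := by
    intro f
    rw [← ha (Finset.univ.image (f.trans g)) (Finset.image_subset_iff.2 fun x _ => hgT (f x))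
      (by rw [Finset.card_image_of_injective _ (f.trans g).injective, Finset.card_univ])]
    ext x
    simp only [Set.mem_ofPred_eq, Finset.coe_image, Finset.coe_univ, Set.image_univ,
      Set.mem_singleton_iff]
    constructor
    · rintro ⟨f', hf', rfl⟩
      rw [RelEmbedding.eq_of_range_eq hf']
    · rintro rfl
      exact ⟨_, rfl, rfl⟩
  exact ⟨g, fun f₁ f₂ => Set.singleton_injective ((key f₁).symm.trans (key f₂))⟩

/-- The product Ramsey theorem for two finite strict total orders. -/
theorem exists_product_ramsey_relEmbedding {A B A' B' : Type}
    [Finite A] [Finite B] [Finite A'] [Finite B']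
    (r : A → A → Prop) (s : B → B → Prop) [IsStrictTotalOrder A r] [IsStrictTotalOrder B s]
    (r' : A' → A' → Prop) (s' : B' → B' → Prop)
    [IsStrictTotalOrder A' r'] [IsStrictTotalOrder B' s'] (κ : Type) [Finite κ] :
    ∃ N M : ℕ, ∀ χ : r ↪r ((· < ·) : Fin N → Fin N → Prop) →
        r' ↪r ((· < ·) : Fin M → Fin M → Prop) → κ,
      ∃ (g : s ↪r ((· < ·) : Fin N → Fin N → Prop))
        (g' : s' ↪r ((· < ·) : Fin M → Fin M → Prop)),
        ∀ (f₁ f₂ : r ↪r s) (f₁' f₂' : r' ↪r s'),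
          χ (f₁.trans g) (f₁'.trans g') = χ (f₂.trans g) (f₂'.trans g') := by
  obtain ⟨N, hN⟩ := exists_ramsey_relEmbedding r s (Set κ)
  have : Finite (r ↪r ((· < ·) : Fin N → Fin N → Prop)) := DFunLike.finite _
  obtain ⟨M, hM⟩ := exists_ramsey_relEmbedding r' s'
    (r ↪r ((· < ·) : Fin N → Fin N → Prop) → κ)
  refine ⟨N, M, fun χ => ?_⟩
  obtain ⟨g', hg'⟩ := hM fun v u => χ u v
  obtain ⟨g, hg⟩ := hN fun u => Set.range fun f' : r' ↪r s' => χ u (f'.trans g')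
  refine ⟨g, g', fun f₁ f₂ f₁' f₂' => ?_⟩
  obtain ⟨f', hf'⟩ := (hg f₁ f₂).subset ⟨f₁', rfl⟩
  exact hf'.symm.trans (congrFun (hg' f' f₂') _)

/-- The grid `Fin N × Fin M` with its two lexicographic orders: the first one compares first
coordinates first, the second one compares second coordinates first. -/
def lexGrid (N M : ℕ) : BinStr (Fin 2) where
  carrier := Fin N × Fin M
  rel := ![fun p q => toLex p < toLex q, fun p q => toLex p.swap < toLex q.swap]

theorem isStrictTotalOrder_lexGrid_zero (N M : ℕ) :
    IsStrictTotalOrder (lexGrid N M).carrier ((lexGrid N M).rel 0) :=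
  (RelEmbedding.preimage (toLex.toEmbedding : Fin N × Fin M ↪ Fin N ×ₗ Fin M)
    (· < ·)).isStrictTotalOrder

theorem isStrictTotalOrder_lexGrid_one (N M : ℕ) :
    IsStrictTotalOrder (lexGrid N M).carrier ((lexGrid N M).rel 1) :=
  (RelEmbedding.preimage
    (((Equiv.prodComm _ _).trans toLex).toEmbedding : Fin N × Fin M ↪ Fin M ×ₗ Fin N)
    (· < ·)).isStrictTotalOrder

/-- A pair of embeddings of the two orders of a structure into `Fin N` and `Fin M` gives an
embedding of the structure into the grid. -/
def BinEmb.toLexGrid {A : BinStr (Fin 2)} {N M : ℕ}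
    (u : A.rel 0 ↪r ((· < ·) : Fin N → Fin N → Prop))
    (v : A.rel 1 ↪r ((· < ·) : Fin M → Fin M → Prop)) : BinEmb A (lexGrid N M) where
  toFun a := (u a, v a)
  inj _ _ h := u.injective (congrArg Prod.fst h)
  map_rel i x y := by
    fin_cases i
    · change A.rel 0 x y ↔ toLex (u x, v x) < toLex (u y, v y)
      rw [Prod.Lex.toLex_lt_toLex, ← u.map_rel_iff]
      refine ⟨Or.inl, fun h => h.resolve_right ?_⟩
      rintro ⟨h₁, h₂⟩
      exact h₂.ne (congrArg v (u.injective h₁))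
    · change A.rel 1 x y ↔ toLex (v x, u x) < toLex (v y, u y)
      rw [Prod.Lex.toLex_lt_toLex, ← v.map_rel_iff]
      refine ⟨Or.inl, fun h => h.resolve_right ?_⟩
      rintro ⟨h₁, h₂⟩
      exact h₂.ne (congrArg u (v.injective h₁))

/-- An embedding of structures is an embedding of each of the relations. -/
def BinEmb.toRelEmbedding {ι : Type} {A B : BinStr ι} (f : BinEmb A B) (i : ι) :
    A.rel i ↪r B.rel i where
  toFun := f.toFun
  inj' := f.inj
  map_rel_iff' := (f.map_rel i _ _).symm

/-- The class of all finite sets equipped with two strict linear orders has the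
Ramsey property. -/
theorem statement3 :
    BinRamseyClass {A : BinStr (Fin 2) |
      Finite A.carrier ∧
        IsStrictTotalOrder A.carrier (A.rel 0) ∧
        IsStrictTotalOrder A.carrier (A.rel 1)} := by
  rintro A ⟨_, _, _⟩ B ⟨_, _, _⟩ r
  obtain ⟨N, M, h⟩ := exists_product_ramsey_relEmbedding
    (A.rel 0) (B.rel 0) (A.rel 1) (B.rel 1) (Fin r)
  refine ⟨lexGrid N M, ⟨inferInstanceAs (Finite (Fin N × Fin M)),
    isStrictTotalOrder_lexGrid_zero N M, isStrictTotalOrder_lexGrid_one N M⟩, fun χ => ?_⟩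
  obtain ⟨g, g', hg⟩ := h fun u v => χ (BinEmb.toLexGrid u v)
  exact ⟨BinEmb.toLexGrid g g', fun f₁ f₂ =>
    hg (f₁.toRelEmbedding 0) (f₂.toRelEmbedding 0) (f₁.toRelEmbedding 1) (f₂.toRelEmbedding 1)⟩
end

section
/- For every n ≥ 1, the class of all finite sets equipped with n strict linear orders (<₁, …, <ₙ) has the Ramsey property: for all finite structures A, B of this kind and all r ∈ ℕ, there exists a finite set C with n strict linear orders such that for every coloring χ : Emb(A,C) → Fin r there is g ∈ Emb(B,C) with χ constant on {g ∘ f : f ∈ Emb(A,B)}. -/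
open Finset in
/-- **Finite Ramsey theorem** for colourings of the `a`-element subsets of a linear order. -/
theorem Finset.exists_card_ramsey (a : ℕ) : ∀ (κ : Type) [Finite κ] [Nonempty κ] (b : ℕ),
    ∃ N : ℕ, ∀ (α : Type) [LinearOrder α] (X : Finset α), N ≤ #X → ∀ χ : Finset α → κ,
      ∃ Y ⊆ X, #Y = b ∧ ∃ k, ∀ s ⊆ Y, #s = a → χ s = k := by
  induction a with
  | zero =>
    intro κ _ _ b
    refine ⟨b, fun α _ X hX χ => ?_⟩
    obtain ⟨Y, hYX, hY⟩ := exists_subset_card_eq hX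
    exact ⟨Y, hYX, hY, χ ∅, fun s _ hs => by rw [card_eq_zero.1 hs]⟩
  | succ a ih =>
    intro κ _ _ b
    -- the colour of a set is made to depend on its least element only
    have end_homogeneous : ∀ m : ℕ, ∃ N : ℕ, ∀ (α : Type) [LinearOrder α] (X : Finset α),
        N ≤ #X → ∀ χ : Finset α → κ, ∃ Y ⊆ X, #Y = m ∧ ∃ c : α → κ,
          ∀ x ∈ Y, ∀ s ⊆ Y, #s = a → (∀ y ∈ s, x < y) → χ (insert x s) = c x := by
      intro m
      induction m with
      | zero =>
        exact ⟨0, fun α _ X _ χ => ⟨∅, empty_subset _, rfl, fun _ => Classical.arbitrary κ,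
          by simp⟩⟩
      | succ m ihm =>
        obtain ⟨M, hM⟩ := ihm
        obtain ⟨N, hN⟩ := ih κ M
        refine ⟨N + 1, fun α _ X hX χ => ?_⟩
        have hne : X.Nonempty := card_pos.1 (by omega)
        set x := X.min' hne with hx
        have hxX : x ∈ X := X.min'_mem hne
        obtain ⟨X', hX', hcard, k, hk⟩ := hN α (X.erase x)
          (by rw [card_erase_of_mem hxX]; omega) (fun s => χ (insert x s))
        obtain ⟨Y, hY, hYm, c, hc⟩ := hM α X' hcard.ge χ
        have hlt : ∀ y ∈ Y, x < y := fun y hy =>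
          X.min'_lt_of_mem_erase_min' hne (hX' (hY hy))
        have hxY : x ∉ Y := fun h => lt_irrefl _ (hlt x h)
        refine ⟨insert x Y, insert_subset hxX ((hY.trans hX').trans (erase_subset _ _)),
          by rw [card_insert_of_notMem hxY, hYm], Function.update c x k, ?_⟩
        intro y hy s hs hsa hys
        have hxs : x ∉ s := by
          intro h
          rcases mem_insert.1 hy with rfl | hy
          · exact lt_irrefl _ (hys _ h)
          · exact lt_asymm (hlt y hy) (hys x h)
        have hsY : s ⊆ Y := (subset_insert_iff_of_notMem hxs).1 hs
        rcases mem_insert.1 hy with rfl | hy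
        · rw [Function.update_self]
          exact hk s (hsY.trans hY) hsa
        · rw [Function.update_of_ne (hlt y hy).ne']
          exact hc y hy s hsY hsa hys
    have := Fintype.ofFinite κ
    classical
    obtain ⟨N, hN⟩ := end_homogeneous (Fintype.card κ * b)
    refine ⟨N, fun α _ X hX χ => ?_⟩
    obtain ⟨Y, hYX, hYm, c, hc⟩ := hN α X hX χ
    obtain ⟨k, -, hk⟩ := exists_le_card_fiber_of_mul_le_card_of_maps_to
      (s := Y) (t := univ) (f := c) (n := b) (fun _ _ => mem_univ _) univ_nonempty
      (by rw [hYm, card_univ])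
    obtain ⟨Z, hZ, hZb⟩ := exists_subset_card_eq hk
    have hZY : Z ⊆ Y := hZ.trans (filter_subset _ _)
    refine ⟨Z, hZY.trans hYX, hZb, k, fun s hs hsa => ?_⟩
    have hne : s.Nonempty := card_pos.1 (by omega)
    have hmem := s.min'_mem hne
    rw [← insert_erase hmem, hc _ (hZY (hs hmem)) _
      ((erase_subset _ _).trans (hs.trans hZY)) (by rw [card_erase_of_mem hmem]; omega)
      (fun y hy => s.min'_lt_of_mem_erase_min' hne hy)]
    exact (mem_filter.1 (hZ (hs hmem))).2

open Finset in
/-- Finite Ramsey theorem for colourings of order embeddings between finite linear orders. -/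
theorem Fin.exists_ramsey_orderEmbedding (κ : Type) [Finite κ] [Nonempty κ] (a b : ℕ) :
    ∃ N : ℕ, ∀ χ : (Fin a ↪o Fin N) → κ, ∃ e : Fin b ↪o Fin N, ∃ k,
      ∀ f : Fin a ↪o Fin b, χ (f.trans e) = k := by
  obtain ⟨N, hN⟩ := Finset.exists_card_ramsey a κ b
  refine ⟨N, fun χ => ?_⟩
  obtain ⟨Y, -, hY, k, hk⟩ := hN (Fin N) univ (by simp) fun s =>
    if h : #s = a then χ (s.orderEmbOfFin h) else Classical.arbitrary κ
  refine ⟨Y.orderEmbOfFin hY, k, fun f => ?_⟩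
  set g := f.trans (Y.orderEmbOfFin hY)
  have hcard : #(univ.map g.toEmbedding) = a := by simp
  have hsub : univ.map g.toEmbedding ⊆ Y := by
    intro y hy
    obtain ⟨x, -, rfl⟩ := mem_map.1 hy
    exact Y.orderEmbOfFin_mem hY (f x)
  have := hk _ hsub hcard
  rw [dif_pos hcard] at this
  rw [← this]
  congr 1
  exact orderEmbOfFin_unique' hcard fun x => mem_map_of_mem _ (mem_univ x)

/-- **Product Ramsey theorem** for colourings of `n`-tuples of order embeddings. -/
theorem Fin.exists_product_ramsey (n : ℕ) (κ : Type) [Finite κ] [Nonempty κ] (a b : ℕ) :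
    ∃ N : ℕ, ∀ χ : (Fin n → (Fin a ↪o Fin N)) → κ, ∃ e : Fin n → (Fin b ↪o Fin N), ∃ k,
      ∀ f : Fin n → (Fin a ↪o Fin b), χ (fun i => (f i).trans (e i)) = k := by
  induction n with
  | zero =>
    refine ⟨0, fun χ => ⟨Fin.elim0, χ Fin.elim0, fun f => ?_⟩⟩
    congr 1
    exact Subsingleton.elim _ _
  | succ n ih =>
    obtain ⟨N, hN⟩ := ih
    obtain ⟨M, hM⟩ :=
      Fin.exists_ramsey_orderEmbedding ((Fin n → (Fin a ↪o Fin N)) → κ) a b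
    let cN : Fin N ↪o Fin (max N M) := Fin.castLEOrderEmb (le_max_left N M)
    let cM : Fin M ↪o Fin (max N M) := Fin.castLEOrderEmb (le_max_right N M)
    refine ⟨max N M, fun χ => ?_⟩
    obtain ⟨e₀, χ₀, he₀⟩ := hM fun g h =>
      χ (Fin.cons (g.trans cM) fun i => (h i).trans cN)
    obtain ⟨e, k, he⟩ := hN χ₀
    refine ⟨Fin.cons (e₀.trans cM) fun i => (e i).trans cN, k, fun f => ?_⟩
    rw [← he fun i => f i.succ, ← he₀ (f 0)]
    congr 1
    funext i
    refine Fin.cases ?_ (fun i => ?_) i <;> rfl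

/-- A finite strict total order is isomorphic to an initial segment of `ℕ`. -/
theorem IsStrictTotalOrder.exists_equiv_fin {α : Type*} [Finite α] (r : α → α → Prop)
    (hr : IsStrictTotalOrder α r) :
    ∃ e : α ≃ Fin (Nat.card α), ∀ x y, r x y ↔ e x < e y := by
  classical
  have := Fintype.ofFinite α
  let := linearOrderOfSTO r
  let e := (Fintype.orderIsoFinOfCardEq α Nat.card_eq_fintype_card.symm).symm
  exact ⟨e.toEquiv, fun x y => e.lt_iff_lt.symm⟩

/-- The grid `[N]ⁿ`, where the `i`-th order compares the `i`-th coordinates first and breaks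
ties lexicographically. -/
def gridStr (n N : ℕ) : BinStr (Fin n) where
  carrier := Fin n → Fin N
  rel i x y := toLex (x i, toLex x) < toLex (y i, toLex y)

theorem gridStr_isStrictTotalOrder (n N : ℕ) (i : Fin n) :
    IsStrictTotalOrder (gridStr n N).carrier ((gridStr n N).rel i) := by
  let φ : (Fin n → Fin N) → Fin N ×ₗ Lex (Fin n → Fin N) := fun x => toLex (x i, toLex x)
  have hφ : Function.Injective φ := fun x y h => by
    simpa [φ] using congrArg (fun p => (ofLex p).2) h
  exact (RelEmbedding.preimage ⟨φ, hφ⟩ (· < ·)).isStrictTotalOrder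

theorem gridStr_rel_iff_of_ne {n N : ℕ} {i : Fin n} {x y : Fin n → Fin N} (h : x i ≠ y i) :
    (gridStr n N).rel i x y ↔ x i < y i := by
  simp [gridStr, Prod.Lex.toLex_lt_toLex, h]

theorem BinEmb.toFun_injective {ι : Type} {A B : BinStr ι} :
    Function.Injective (BinEmb.toFun : BinEmb A B → A.carrier → B.carrier) := by
  rintro ⟨⟩ ⟨⟩ rfl
  rfl

/-- The embedding into the grid whose `i`-th coordinate is an order embedding for the `i`-th
order. -/
def BinEmb.toGrid {n N a : ℕ} (hn : 1 ≤ n) {A : BinStr (Fin n)} (ρ : Fin n → (A.carrier ≃ Fin a))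
    (hρ : ∀ i x y, A.rel i x y ↔ ρ i x < ρ i y) (h : Fin n → (Fin a ↪o Fin N)) :
    BinEmb A (gridStr n N) where
  toFun x i := h i (ρ i x)
  inj x y hxy := (ρ ⟨0, hn⟩).injective ((h ⟨0, hn⟩).injective (congrFun hxy ⟨0, hn⟩))
  map_rel i x y := by
    rw [hρ]
    by_cases hxy : x = y
    · subst hxy
      exact iff_of_false (lt_irrefl _) (lt_irrefl _)
    · rw [gridStr_rel_iff_of_ne fun e => hxy ((ρ i).injective ((h i).injective e))]
      exact (h i).lt_iff_lt.symm

/-- The order embedding induced by an embedding of structures on ranks for the `i`-th order. -/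
def BinEmb.rankEmb {n a b : ℕ} {A B : BinStr (Fin n)} (f : BinEmb A B) (i : Fin n)
    (ρ : A.carrier ≃ Fin a) (hρ : ∀ x y, A.rel i x y ↔ ρ x < ρ y)
    (σ : B.carrier ≃ Fin b) (hσ : ∀ x y, B.rel i x y ↔ σ x < σ y) : Fin a ↪o Fin b :=
  OrderEmbedding.ofStrictMono (fun x => σ (f.toFun (ρ.symm x))) fun x y hxy => by
    rw [← hσ, ← f.map_rel, hρ]
    simpa using hxy

/-- For every `n ≥ 1`, the class of all finite sets equipped with `n` strict linear orders
has the Ramsey property. -/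
theorem statement4 :
    ∀ n : ℕ, 1 ≤ n →
      BinRamseyClass {A : BinStr (Fin n) |
        Finite A.carrier ∧ ∀ i : Fin n, IsStrictTotalOrder A.carrier (A.rel i)} := by
  rintro n hn A ⟨hAfin, hA⟩ B ⟨hBfin, hB⟩ r
  rcases Nat.eq_zero_or_pos r with rfl | hr
  · exact ⟨B, ⟨hBfin, hB⟩, fun χ =>
      ⟨⟨id, Function.injective_id, fun _ _ _ => Iff.rfl⟩, fun f => (χ f).elim0⟩⟩
  have : Nonempty (Fin r) := ⟨⟨0, hr⟩⟩
  choose ρ hρ using fun i => (hA i).exists_equiv_fin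
  choose σ hσ using fun i => (hB i).exists_equiv_fin
  obtain ⟨N, hN⟩ := Fin.exists_product_ramsey n (Fin r) (Nat.card A.carrier) (Nat.card B.carrier)
  refine ⟨gridStr n N, ⟨inferInstanceAs (Finite (Fin n → Fin N)),
    gridStr_isStrictTotalOrder n N⟩, fun χ => ?_⟩
  obtain ⟨e, k, he⟩ := hN fun h => χ (BinEmb.toGrid hn ρ hρ h)
  have key : ∀ f : BinEmb A B, χ ((BinEmb.toGrid hn σ hσ e).comp f) = k := by
    intro f
    rw [← he fun i => f.rankEmb i (ρ i) (hρ i) (σ i) (hσ i)]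
    refine congrArg χ (BinEmb.toFun_injective ?_)
    funext x i
    change e i (σ i (f.toFun x)) = e i (σ i (f.toFun ((ρ i).symm (ρ i x))))
    rw [Equiv.symm_apply_apply]
  exact ⟨BinEmb.toGrid hn σ hσ e, fun f₁ f₂ => (key f₁).trans (key f₂).symm⟩
end

section
/- The class of all finite structures (X, ≺, <₁, <₂), where ≺ is a strict partial order, <₁ is a strict linear order extending ≺ (i.e., x ≺ y implies x <₁ y), and <₂ is an arbitrary strict linear order, has the Ramsey property: for all A, B in this class and all r ∈ ℕ there exists C in this class such that every coloring χ : Emb(A,C) → Fin r is constant on {g ∘ f : f ∈ Emb(A,B)} for some g ∈ Emb(B,C). -/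
/-- `RigidWord a b w` says that `w` is a word in the letters `0, …, b - 1` in which every letter
of `{a, …, b - 1}` occurs, the first occurrences of these letters being in increasing order. -/
inductive RigidWord : ℕ → ℕ → List ℕ → Prop
  | nil (a : ℕ) : RigidWord a a []
  | old {a b x : ℕ} {w : List ℕ} : x < a → RigidWord a b w → RigidWord a b (x :: w)
  | new {a b : ℕ} {w : List ℕ} : RigidWord (a + 1) b w → RigidWord a b (a :: w)

/-- Replace every letter `x` of the word `w` by the `x`-th letter of `U`. -/
def wordSubst (U w : List ℕ) : List ℕ := w.map fun x => U.getD x 0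

/-- Replace the letters `a, a + 1, …` of `w` by the letters of `u`, fixing those below `a`. -/
def paramSubst (a : ℕ) (u w : List ℕ) : List ℕ := wordSubst (List.range a ++ u) w

namespace RigidWord

lemma le {a b : ℕ} {w : List ℕ} (h : RigidWord a b w) : a ≤ b := by
  induction h <;> omega

lemma lt_of_mem {a b : ℕ} {w : List ℕ} (h : RigidWord a b w) : ∀ x ∈ w, x < b := by
  induction h with
  | nil => simp
  | old hx h ih => simpa using ⟨hx.trans_le h.le, ih⟩
  | new h ih => simpa using ⟨h.le, ih⟩

lemma mem {a b : ℕ} {w : List ℕ} (h : RigidWord a b w) : ∀ x, a ≤ x → x < b → x ∈ w := by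
  induction h with
  | nil => omega
  | old hx h ih => exact fun y h1 h2 => List.mem_cons_of_mem _ (ih y h1 h2)
  | @new a b w h ih =>
    intro y h1 h2
    rcases h1.eq_or_lt with rfl | h1
    · simp
    · exact List.mem_cons_of_mem _ (ih y h1 h2)

lemma append {a b c : ℕ} {v w : List ℕ} (h : RigidWord a b v) (h' : RigidWord b c w) :
    RigidWord a c (v ++ w) := by
  induction h with
  | nil => exact h'
  | old hx h ih => exact .old hx (ih h')
  | new h ih => exact .new (ih h')

lemma of_forall_lt {a : ℕ} {w : List ℕ} (h : ∀ x ∈ w, x < a) : RigidWord a a w := by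
  induction w with
  | nil => exact .nil a
  | cons x w ih => exact .old (h x (by simp)) (ih fun y hy => h y (by simp [hy]))

lemma range' (a m : ℕ) : RigidWord a (a + m) (List.range' a m) := by
  induction m generalizing a with
  | zero => exact .nil a
  | succ m ih =>
    have := ih (a + 1)
    rw [add_assoc, add_comm 1] at this
    exact this.new

lemma of_mem {a : ℕ} {w : List ℕ} (h : ∀ x ∈ w, x ≤ a) (ha : a ∈ w) : RigidWord a (a + 1) w := by
  induction w with
  | nil => simp at ha
  | cons x w ih =>
    rcases (h x (by simp)).eq_or_lt with rfl | hx
    · exact .new (of_forall_lt fun y hy => Nat.lt_succ_of_le (h y (by simp [hy])))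
    · refine .old hx (ih (fun y hy => h y (by simp [hy])) ?_)
      simpa [hx.ne'] using ha

lemma subst {c d : ℕ} {w : List ℕ} (h : RigidWord c d w) {U u : List ℕ} {e b : ℕ}
    (hU : U.length = c) (hu : U.length + u.length = d) (hlt : ∀ x ∈ U, x < e)
    (h' : RigidWord e b u) : RigidWord e b (wordSubst (U ++ u) w) := by
  induction h generalizing U u e with
  | nil a =>
    obtain rfl : u = [] := List.length_eq_zero_iff.mp (by omega)
    exact h'
  | @old a b' x w hx h ih =>
    refine .old ?_ (ih hU hu hlt h')
    beta_reduce
    rw [List.getD_append _ _ _ _ (by omega), List.getD_eq_getElem _ _ (by omega)]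
    exact hlt _ (List.getElem_mem _)
  | @new a b' w h ih =>
    have hle := h.le
    have hget : ∀ y v, (U ++ y :: v).getD a 0 = y := by
      intro y v
      rw [List.getD_append_right _ _ _ _ hU.le]
      simp [hU]
    cases h' with
    | nil => simp at hu; omega
    | @old _ _ y v hy h' =>
      have := ih (U := U ++ [y]) (u := v) (e := e) (by simp [hU])
        (by simp at hu ⊢; omega) (by simpa [or_imp, forall_and] using ⟨hlt, hy⟩) h'
      simp only [wordSubst, List.map_cons, hget]
      exact .old hy (by simpa [wordSubst] using this)
    | @new _ _ v h' =>
      have := ih (U := U ++ [e]) (u := v) (e := e + 1) (by simp [hU])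
        (by simp at hu ⊢; omega)
        (by simpa [or_imp, forall_and] using fun x hx => (hlt x hx).trans (Nat.lt_succ_self e)) h'
      simp only [wordSubst, List.map_cons, hget]
      exact .new (by simpa [wordSubst] using this)

lemma paramSubst {a m b : ℕ} {u w : List ℕ} (h : RigidWord a (a + m) w) (hu : u.length = m)
    (h' : RigidWord a b u) : RigidWord a b (paramSubst a u w) :=
  h.subst (by simp) (by simp [hu]) (by simp) h'

lemma shift {c d a : ℕ} {w : List ℕ} (h : RigidWord c d w) (hac : a ≤ c) :
    RigidWord (c + 1) (d + 1) (w.map fun x => if x < a then x else x + 1) := by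
  induction h with
  | nil => exact .nil _
  | old hx h ih => exact .old (by beta_reduce; split <;> omega) (ih hac)
  | new h ih =>
    simp only [List.map_cons, if_neg (not_lt.mpr hac)]
    exact .new (ih (by omega))

end RigidWord

@[simp] lemma length_wordSubst (U w : List ℕ) : (wordSubst U w).length = w.length := by
  simp [wordSubst]

@[simp] lemma length_paramSubst (a : ℕ) (u w : List ℕ) :
    (paramSubst a u w).length = w.length := by
  simp [paramSubst]

lemma wordSubst_wordSubst {U V w : List ℕ} (h : ∀ x ∈ w, x < U.length) :
    wordSubst V (wordSubst U w) = wordSubst (wordSubst V U) w := by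
  simp only [wordSubst, List.map_map]
  refine List.map_congr_left fun x hx => ?_
  have := h x hx
  simp [this]

lemma wordSubst_append (U v w : List ℕ) :
    wordSubst U (v ++ w) = wordSubst U v ++ wordSubst U w := by
  simp [wordSubst]

lemma wordSubst_range_append (U u : List ℕ) :
    wordSubst (U ++ u) (List.range U.length) = U := by
  refine List.ext_getElem (by simp) fun i h1 h2 => ?_
  simp [wordSubst, List.getElem?_append_left h2, h2]

lemma wordSubst_congr {U V w : List ℕ} (h : ∀ x ∈ w, U.getD x 0 = V.getD x 0) :
    wordSubst U w = wordSubst V w :=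
  List.map_congr_left h

lemma wordSubst_append_left {U V w : List ℕ} (h : ∀ x ∈ w, x < U.length) :
    wordSubst (U ++ V) w = wordSubst U w :=
  wordSubst_congr fun x hx => List.getD_append _ _ _ _ (h x hx)

lemma paramSubst_paramSubst {a m : ℕ} {u v w : List ℕ} (h : ∀ x ∈ w, x < a + m)
    (hv : v.length = m) :
    paramSubst a u (paramSubst a v w) = paramSubst a (paramSubst a u v) w := by
  have := wordSubst_range_append (List.range a) u
  rw [List.length_range] at this
  simp only [paramSubst]
  rw [wordSubst_wordSubst (by simpa [hv] using h), wordSubst_append, this]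

lemma paramSubst_append_right (a : ℕ) (u v w : List ℕ) :
    paramSubst a u (v ++ w) = paramSubst a u v ++ paramSubst a u w :=
  wordSubst_append _ _ _

lemma paramSubst_shift (a x : ℕ) (u w : List ℕ) :
    paramSubst a (x :: u) (w.map fun y => if y < a then y else y + 1) = paramSubst a u w := by
  simp only [paramSubst, wordSubst, List.map_map]
  refine List.map_congr_left fun y _ => ?_
  by_cases hy : y < a
  · simp [hy, List.getElem?_append_left]
  · have : y + 1 - a = (y - a) + 1 := by omega
    simp only [Function.comp_apply, if_neg hy]
    rw [List.getD_append_right _ _ _ _ (by simp; omega),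
      List.getD_append_right _ _ _ _ (by simp; omega)]
    simp [this]

lemma exists_mono_line (a : ℕ) (κ : Type) [Finite κ] : ∃ n, ∀ χ : List ℕ → κ, ∃ w,
    RigidWord a (a + 1) w ∧ w.length = n ∧ ∃ c, ∀ x < a, χ (paramSubst a [x] w) = c := by
  obtain ⟨ι, _, h⟩ := Combinatorics.Line.exists_mono_in_high_dimension (Fin a) κ
  let e := Fintype.equivFin ι
  refine ⟨Fintype.card ι, fun χ => ?_⟩
  obtain ⟨l, c, hc⟩ := h fun v => χ (List.ofFn fun i => (v (e.symm i) : ℕ))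
  refine ⟨List.ofFn fun i => ((l.idxFun (e.symm i)).map Fin.val).getD a, ?_, by simp, c, ?_⟩
  · refine RigidWord.of_mem ?_ ?_
    · intro x hx
      obtain ⟨i, rfl⟩ := (List.mem_ofFn' _ _).mp hx
      cases hi : l.idxFun (e.symm i) with
      | none => simp [hi]
      | some y => simp [hi]
    · obtain ⟨i, hi⟩ := l.proper
      exact (List.mem_ofFn' _ _).mpr ⟨e i, by simp [hi]⟩
  · intro x hx
    rw [← hc ⟨x, hx⟩]
    congr 1
    simp only [paramSubst, wordSubst, List.map_ofFn]
    congr 1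
    funext i
    simp only [Function.comp_apply, Combinatorics.Line.coe_apply]
    cases l.idxFun (e.symm i) with
    | none => simp
    | some y => simp

lemma exists_mono_paramSubst {a : ℕ} (ha : 0 < a) (m : ℕ) (κ : Type) [Finite κ] :
    ∃ n, ∀ χ : List ℕ → κ, ∃ w, RigidWord a (a + m) w ∧ w.length = n ∧
      ∃ c, ∀ u : List ℕ, u.length = m → (∀ x ∈ u, x < a) → χ (paramSubst a u w) = c := by
  induction m with
  | zero =>
    refine ⟨0, fun χ => ⟨[], .nil a, rfl, χ [], fun u _ _ => rfl⟩⟩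
  | succ m ih =>
    obtain ⟨n₂, h₂⟩ := ih
    obtain ⟨n₁, h₁⟩ := exists_mono_line a ((Fin n₂ → Fin a) → κ)
    refine ⟨n₁ + n₂, fun χ => ?_⟩
    obtain ⟨w₁, hw₁, hl₁, c₁, hc₁⟩ := h₁ fun v g => χ (v ++ List.ofFn fun i => (g i : ℕ))
    obtain ⟨w₂, hw₂, hl₂, c, hc⟩ := h₂ fun y => χ (paramSubst a [0] w₁ ++ y)
    refine ⟨w₁ ++ w₂.map fun y => if y < a then y else y + 1, ?_, by simp [hl₁, hl₂], c, ?_⟩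
    · have := hw₂.shift le_rfl
      rw [add_assoc] at this
      exact hw₁.append this
    · rintro (_ | ⟨x, u⟩) hu hlt
      · simp at hu
      · simp only [List.mem_cons, forall_eq_or_imp] at hlt
        rw [paramSubst_append_right, paramSubst_shift]
        have h1 : paramSubst a (x :: u) w₁ = paramSubst a [x] w₁ := by
          have : List.range a ++ x :: u = (List.range a ++ [x]) ++ u := by simp
          rw [paramSubst, this, wordSubst_append_left (by simpa using hw₁.lt_of_mem)]
          rfl
        have hy : ∀ y ∈ paramSubst a u w₂, y < a :=
          ((hw₂.paramSubst (by simpa using hu) (RigidWord.of_forall_lt hlt.2))).lt_of_mem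
        have hlen : (paramSubst a u w₂).length = n₂ := by simp [hl₂]
        rw [h1, ← hc u (by simpa using hu) hlt.2]
        have key := fun x hx => congrFun (hc₁ x hx)
          fun i => ⟨(paramSubst a u w₂)[i], hy _ (List.getElem_mem _)⟩
        have hof : (List.ofFn fun i : Fin n₂ => (paramSubst a u w₂)[i]) = paramSubst a u w₂ :=
          List.ext_getElem (by simp [hl₂]) (by simp)
        simp only [hof] at key
        rw [key x hlt.1, key 0 ha]

/-- The finite Graham-Rothschild theorem for words with `a` constant letters and `k` parameters:
for every finite colouring of these words, there is an `m`-parameter word all of whose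
`k`-parameter subwords have the same colour. -/
def GrahamRothschild (a k : ℕ) : Prop :=
  ∀ (m : ℕ) (κ : Type) [Finite κ], ∃ n, ∀ χ : List ℕ → κ, ∃ w, RigidWord a (a + m) w ∧
    w.length = n ∧ ∃ c, ∀ u, RigidWord a (a + k) u → u.length = m → χ (paramSubst a u w) = c

/-- The longest prefix of a word which contains only letters below `a`. -/
abbrev constPrefix (a : ℕ) (u : List ℕ) : List ℕ := u.takeWhile (· < a)

lemma GrahamRothschild.exists_constPrefix {a k : ℕ} (h : GrahamRothschild (a + 1) k) (m : ℕ)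
    (κ : Type) [Finite κ] : ∃ n, ∀ χ : List ℕ → κ, ∃ w, RigidWord a (a + m) w ∧
      w.length = n ∧ ∃ F : List ℕ → κ, ∀ u, RigidWord a (a + (k + 1)) u → u.length = m →
        χ (paramSubst a u w) = F (constPrefix a u) := by
  induction m generalizing κ with
  | zero =>
    refine ⟨0, fun χ => ⟨[], .nil a, rfl, fun _ => χ [], fun u _ _ => rfl⟩⟩
  | succ m ih =>
    obtain ⟨M, hM⟩ := ih (Fin a → κ)
    obtain ⟨n, hn⟩ := h M κ
    refine ⟨n + 1, fun χ => ?_⟩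
    obtain ⟨w₁, hw₁, hl₁, c, hc⟩ := hn fun y => χ (a :: y)
    obtain ⟨w₂, hw₂, hl₂, F, hF⟩ := hM fun y x => χ (x :: paramSubst a (x :: y) w₁)
    set v := w₂.map fun y => if y < a then y else y + 1 with hv
    have hvl : v.length = M := by simp [hv, hl₂]
    have hv' : RigidWord (a + 1) (a + 1 + m) v := by
      have := hw₂.shift le_rfl
      rwa [add_right_comm] at this
    have hsub : ∀ x u, paramSubst a (x :: u) (a :: paramSubst (a + 1) v w₁) =
        x :: paramSubst a (x :: paramSubst a u w₂) w₁ := by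
      intro x u
      have h1 : paramSubst a (x :: u) [a] = [x] := by simp [paramSubst, wordSubst]
      have h2 : wordSubst (List.range a ++ x :: u) (List.range (a + 1)) = List.range a ++ [x] := by
        have := wordSubst_range_append (List.range a ++ [x]) u
        simpa using this
      rw [← List.singleton_append (x := a), paramSubst_append_right, h1, ← paramSubst_shift a x u,
        ← hv]
      simp only [List.singleton_append, List.cons.injEq, true_and]
      simp only [paramSubst]
      rw [wordSubst_wordSubst (by simpa [hvl] using hw₁.lt_of_mem), wordSubst_append, h2]
      simp
    refine ⟨a :: paramSubst (a + 1) v w₁, ?_, by simp [hl₁], fun p => match p with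
      | [] => c
      | x :: p => if hx : x < a then F p ⟨x, hx⟩ else c, ?_⟩
    · have := hw₁.paramSubst hvl hv'
      rw [add_right_comm] at this
      exact .new this
    · intro u hu hlen
      cases hu with
      | @old _ _ x u hx hu =>
        have := congrFun (hF u hu (by simpa using hlen)) ⟨x, hx⟩
        rw [hsub, this]
        simp [constPrefix, hx]
      | @new _ _ u hu =>
        have hu' : RigidWord (a + 1) (a + 1 + k) u := by convert hu using 1; omega
        have hlen' : u.length = m := by simpa using hlen
        have hcomp : paramSubst a (a :: paramSubst a u w₂) w₁ =
            paramSubst (a + 1) (paramSubst (a + 1) u v) w₁ := by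
          rw [← paramSubst_shift a a u w₂, ← hv]
          simp [paramSubst, List.range_succ]
        rw [hsub, hcomp, hc _ (hv'.paramSubst hlen' hu') (by simp [hvl])]
        simp [constPrefix]

lemma constPrefix_wordSubst_congr {a c d : ℕ} {w : List ℕ} (h : RigidWord c d w)
    {U u v : List ℕ} (hU : U.length = c) (hlt : ∀ x ∈ U, x < a) (hu : d ≤ c + u.length)
    (hv : d ≤ c + v.length) (huv : constPrefix a u = constPrefix a v) :
    constPrefix a (wordSubst (U ++ u) w) = constPrefix a (wordSubst (U ++ v) w) := by
  induction h generalizing U u v with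
  | nil => rfl
  | @old c d x w hx h ih =>
    have hget : ∀ y : List ℕ, (U ++ y).getD x 0 = U.getD x 0 :=
      fun y => List.getD_append _ _ _ _ (by omega)
    have := ih hU hlt hu hv huv
    simp only [constPrefix, wordSubst] at this
    simp only [constPrefix, wordSubst, List.map_cons, hget, List.takeWhile_cons]
    rw [this]
  | @new c d w h ih =>
    have hle := h.le
    have hget : ∀ y v, (U ++ y :: v).getD c 0 = y := by
      intro y v
      rw [List.getD_append_right _ _ _ _ hU.le]
      simp [hU]
    rcases u with _ | ⟨y, u⟩
    · simp at hu; omega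
    rcases v with _ | ⟨z, v⟩
    · simp at hv; omega
    simp only [constPrefix, wordSubst, List.map_cons, hget]
    by_cases hy : y < a <;> by_cases hz : z < a <;> simp [constPrefix, hy, hz] at huv ⊢
    obtain ⟨rfl, huv⟩ := huv
    have := ih (U := U ++ [y]) (u := u) (v := v) (by simp [hU])
      (by simpa [or_imp, forall_and] using ⟨hlt, hy⟩)
      (by simp at hu; omega) (by simp at hv; omega) huv
    simpa [constPrefix, wordSubst] using this

lemma constPrefix_paramSubst_congr {a m : ℕ} {w u v : List ℕ} (h : RigidWord a (a + m) w)
    (hu : m ≤ u.length) (hv : m ≤ v.length) (huv : constPrefix a u = constPrefix a v) :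
    constPrefix a (paramSubst a u w) = constPrefix a (paramSubst a v w) :=
  constPrefix_wordSubst_congr h (by simp) (by simp) (by omega) (by omega) huv

lemma constPrefix_append {a : ℕ} {u v : List ℕ} (h : ∃ x ∈ u, a ≤ x) :
    constPrefix a (u ++ v) = constPrefix a u := by
  obtain ⟨x, hx, hax⟩ := h
  induction u with
  | nil => simp at hx
  | cons y u ih =>
    by_cases hy : y < a
    · have : x ∈ u := by
        rcases List.mem_cons.mp hx with rfl | hx
        · omega
        · exact hx
      simpa [constPrefix, hy] using ih this
    · simp [constPrefix, hy]

lemma constPrefix_append_of_forall {a : ℕ} {u v : List ℕ} (h : ∀ x ∈ u, x < a) :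
    constPrefix a (u ++ v) = u ++ constPrefix a v := by
  induction u with
  | nil => simp
  | cons y u ih =>
    have hy := h y (by simp)
    simpa [constPrefix, hy] using ih fun x hx => h x (by simp [hx])

lemma exists_ge_paramSubst {a m : ℕ} {u w : List ℕ} (h : RigidWord a (a + m) w)
    (hu : u.length = m) (hx : ∃ x ∈ u, a ≤ x) : ∃ x ∈ paramSubst a u w, a ≤ x := by
  obtain ⟨x, hx, hax⟩ := hx
  obtain ⟨i, hi, rfl⟩ := List.getElem_of_mem hx
  refine ⟨u[i], List.mem_map.mpr ⟨a + i, h.mem _ (by omega) (by omega), ?_⟩, hax⟩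
  rw [List.getD_append_right _ _ _ _ (by simp)]
  simp [hi]

lemma exists_constPrefix_length {a : ℕ} (ha : 0 < a) (m : ℕ) (κ : Type) [Finite κ] :
    ∃ n, ∀ F : List ℕ → κ, ∃ w, RigidWord a (a + m) w ∧ w.length = n ∧
      ∃ G : ℕ → κ, ∀ u : List ℕ, u.length = m → (∃ x ∈ u, a ≤ x) →
        F (constPrefix a (paramSubst a u w)) = G (constPrefix a u).length := by
  induction m with
  | zero =>
    refine ⟨0, fun F => ⟨[], .nil a, rfl, fun _ => F [], fun u _ _ => rfl⟩⟩
  | succ m ih =>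
    obtain ⟨M, hM⟩ := ih
    obtain ⟨N, hN⟩ := exists_mono_paramSubst ha M κ
    refine ⟨N + 1, fun F => ?_⟩
    obtain ⟨w₁, hw₁, hl₁, c, hc⟩ := hN F
    obtain ⟨w₂, hw₂, hl₂, G, hG⟩ := hM fun q =>
      F (constPrefix a (paramSubst a (q ++ List.replicate M a) w₁))
    refine ⟨paramSubst a w₂ w₁ ++ [a + m], ?_, by simp [hl₁],
      fun l => if l = m then c else G l, ?_⟩
    · exact (hw₁.paramSubst hl₂ hw₂).append (.new (.nil _))
    · intro u hu hex
      obtain ⟨v, z, rfl⟩ : ∃ v z, u = v ++ [z] := by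
        rcases List.eq_nil_or_concat u with rfl | ⟨v, z, rfl⟩
        · simp at hu
        · exact ⟨v, z, by simp⟩
      have hv : v.length = m := by simpa using hu
      have hz : paramSubst a (v ++ [z]) [a + m] = [z] := by
        simp [paramSubst, wordSubst, hv]
      have hcomp : paramSubst a (v ++ [z]) (paramSubst a w₂ w₁) =
          paramSubst a (paramSubst a v w₂) w₁ := by
        rw [paramSubst_paramSubst hw₁.lt_of_mem hl₂]
        congr 1
        rw [paramSubst, ← List.append_assoc,
          wordSubst_append_left (by simpa [hv] using hw₂.lt_of_mem)]
        rfl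
      rw [paramSubst_append_right, hz, hcomp]
      by_cases hvex : ∃ x ∈ v, a ≤ x
      · have hlt : (constPrefix a v).length ≠ m := by
          intro h
          have h1 : constPrefix a v = v :=
            (List.takeWhile_prefix _).eq_of_length (h.trans hv.symm)
          obtain ⟨x, hx, hax⟩ := hvex
          have := List.takeWhile_eq_self_iff.mp h1 x hx
          simp at this
          omega
        beta_reduce
        rw [constPrefix_append hvex, if_neg hlt, ← hG v hv hvex, constPrefix_append]
        · congr 1
          refine constPrefix_paramSubst_congr hw₁ (by simp [hl₂]) (by simp) ?_
          rw [constPrefix_append_of_forall]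
          · cases M <;> simp [constPrefix, List.replicate_succ]
          · intro x hx
            simpa using List.mem_takeWhile_imp hx
        · exact exists_ge_paramSubst hw₁ (by simp [hl₂]) (exists_ge_paramSubst hw₂ hv hvex)
      · push Not at hvex
        have hza : ¬ z < a := by
          obtain ⟨x, hx, hax⟩ := hex
          rcases List.mem_append.mp hx with hx | hx
          · exact absurd (hvex x hx) (by omega)
          · simp at hx; omega
        have hy := (hw₂.paramSubst hv (.of_forall_lt hvex)).lt_of_mem
        have hy' := (hw₁.paramSubst (by simp [hl₂]) (.of_forall_lt hy)).lt_of_mem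
        rw [constPrefix_append_of_forall hvex, constPrefix_append_of_forall hy']
        simp [constPrefix, hza, hv, hc _ (by simp [hl₂] : _ = M) hy]

/-- The word with consecutive parameters `c, c + 1, …` at the marked positions and the
letter `0` elsewhere. -/
def maskWord : ℕ → List Bool → List ℕ
  | _, [] => []
  | c, true :: l => c :: maskWord (c + 1) l
  | c, false :: l => 0 :: maskWord c l

@[simp] lemma length_maskWord (c : ℕ) (l : List Bool) : (maskWord c l).length = l.length := by
  induction l generalizing c with
  | nil => rfl
  | cons b l ih => cases b <;> simp [maskWord, ih]

lemma rigidWord_maskWord {c : ℕ} (hc : 0 < c) (l : List Bool) :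
    RigidWord c (c + l.count true) (maskWord c l) := by
  induction l generalizing c with
  | nil => exact .nil c
  | cons b l ih =>
    cases b
    · simpa [maskWord] using RigidWord.old hc (ih hc)
    · have := ih (Nat.succ_pos c)
      rw [Nat.succ_eq_add_one, add_assoc, add_comm 1] at this
      simpa [maskWord] using this.new

lemma getElem?_constPrefix_maskWord {a c : ℕ} (hc : 0 < c) {l : List Bool} {U u : List ℕ}
    (hU : U.length = c) (hlt : ∀ x ∈ U, x < a) (hu : u.length = l.count true)
    (hex : ∃ x ∈ u, a ≤ x) :
    l[(constPrefix a (wordSubst (U ++ u) (maskWord c l))).length]? = some true := by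
  induction l generalizing c U u with
  | nil =>
    obtain ⟨x, hx, -⟩ := hex
    obtain rfl : u = [] := List.length_eq_zero_iff.mp (by simpa using hu)
    simp at hx
  | cons b l ih =>
    cases b
    · have h0 : (U ++ u).getD 0 0 < a := by
        rw [List.getD_append _ _ _ _ (by omega), List.getD_eq_getElem _ _ (by omega)]
        exact hlt _ (List.getElem_mem _)
      have := ih hc hU hlt (by simpa using hu) hex
      simp only [constPrefix, wordSubst] at this
      simp only [maskWord, constPrefix, wordSubst, List.map_cons]
      rw [List.takeWhile_cons_of_pos (by simpa using h0)]
      simpa using this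
    · rcases u with _ | ⟨y, u⟩
      · simp at hu
      have hget : (U ++ y :: u).getD c 0 = y := by
        rw [List.getD_append_right _ _ _ _ hU.le]
        simp [hU]
      simp only [maskWord, constPrefix, wordSubst, List.map_cons, hget]
      by_cases hy : y < a
      · have hex' : ∃ x ∈ u, a ≤ x := by
          obtain ⟨x, hx, hax⟩ := hex
          rcases List.mem_cons.mp hx with rfl | hx
          · omega
          · exact ⟨x, hx, hax⟩
        have := ih (Nat.succ_pos c) (U := U ++ [y]) (by simp [hU])
          (by simpa [or_imp, forall_and] using ⟨hlt, hy⟩) (by simpa using hu) hex'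
        rw [List.takeWhile_cons_of_pos (by simpa using hy)]
        simpa [constPrefix, wordSubst] using this
      · simp [hy]

lemma exists_mono_constPrefix_length {a : ℕ} (ha : 0 < a) (m : ℕ) (κ : Type) [Finite κ] :
    ∃ n, ∀ G : ℕ → κ, ∃ w, RigidWord a (a + m) w ∧ w.length = n ∧
      ∃ c, ∀ u : List ℕ, u.length = m → (∃ x ∈ u, a ≤ x) →
        G (constPrefix a (paramSubst a u w)).length = c := by
  classical
  have := Fintype.ofFinite κ
  refine ⟨Fintype.card κ * m + 1, fun G => ?_⟩
  obtain ⟨c, -, hc⟩ := Finset.exists_lt_card_fiber_of_mul_lt_card_of_maps_to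
    (s := Finset.range (Fintype.card κ * m + 1)) (t := Finset.univ) (f := G) (n := m)
    (by simp) (by simp)
  obtain ⟨S, hS, hSm⟩ := Finset.exists_subset_card_eq hc.le
  set l := (List.range (Fintype.card κ * m + 1)).map fun i => decide (i ∈ S) with hl
  have hcount : l.count true = m := by
    rw [hl, List.count, List.countP_map, List.countP_eq_length_filter, ← hSm]
    rw [← List.toFinset_card_of_nodup (List.nodup_range.filter _)]
    congr 1
    ext i
    simp only [List.mem_toFinset, List.mem_filter, List.mem_range, Function.comp_apply, beq_true,
      decide_eq_true_eq, and_iff_right_iff_imp]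
    intro hi
    simpa [hSm] using (Finset.mem_filter.mp (hS hi)).1
  refine ⟨maskWord a l, ?_, by simp [hl], c, fun u hu hex => ?_⟩
  · rw [← hcount]
    exact rigidWord_maskWord ha l
  · have := getElem?_constPrefix_maskWord ha (l := l) (a := a) (U := List.range a) (u := u)
      (by simp) (by simp) (by omega) hex
    rw [← paramSubst] at this
    have hmem : (constPrefix a (paramSubst a u (maskWord a l))).length ∈ S := by
      simp only [hl, List.getElem?_map, Option.map_eq_some_iff] at this
      obtain ⟨i, hi, hi'⟩ := this
      obtain ⟨_, rfl⟩ := List.getElem?_eq_some_iff.mp hi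
      simpa using hi'
    exact (Finset.mem_filter.mp (hS hmem)).2

theorem grahamRothschild {a : ℕ} (ha : 0 < a) (k : ℕ) : GrahamRothschild a k := by
  induction k generalizing a with
  | zero =>
    intro m κ _
    obtain ⟨n, hn⟩ := exists_mono_paramSubst ha m κ
    refine ⟨n, fun χ => ?_⟩
    obtain ⟨w, hw, hl, c, hc⟩ := hn χ
    exact ⟨w, hw, hl, c, fun u hu hm => hc u hm hu.lt_of_mem⟩
  | succ k ih =>
    intro m κ _
    obtain ⟨M₀, h₀⟩ := exists_mono_constPrefix_length ha m κ
    obtain ⟨M₁, h₁⟩ := exists_constPrefix_length ha M₀ κ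
    obtain ⟨n, h₂⟩ := (ih (Nat.succ_pos a)).exists_constPrefix M₁ κ
    refine ⟨n, fun χ => ?_⟩
    obtain ⟨w₂, hw₂, hl₂, F, hF⟩ := h₂ χ
    obtain ⟨w₁, hw₁, hl₁, G, hG⟩ := h₁ F
    obtain ⟨w₀, hw₀, hl₀, c, hc⟩ := h₀ G
    refine ⟨paramSubst a (paramSubst a w₀ w₁) w₂, ?_, by simp [hl₂], c, fun u hu hm => ?_⟩
    · exact hw₂.paramSubst (by simp [hl₁]) (hw₁.paramSubst hl₀ hw₀)
    · have hex : ∃ x ∈ u, a ≤ x := ⟨a, hu.mem a le_rfl (by omega), le_rfl⟩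
      rw [paramSubst_paramSubst hw₂.lt_of_mem (by simp [hl₁]),
        paramSubst_paramSubst hw₁.lt_of_mem hl₀,
        hF _ (hw₁.paramSubst (by simp [hl₀]) (hw₀.paramSubst hm hu)) (by simp [hl₁]),
        hG _ (by simp [hl₀]) (exists_ge_paramSubst hw₀ hm hex), hc u hm hex]

/-- The finite dual Ramsey theorem, for rigid surjections represented as words. -/
theorem dualRamsey (k m : ℕ) (κ : Type) [Finite κ] : ∃ n, ∀ χ : List ℕ → κ, ∃ w,
    RigidWord 0 m w ∧ w.length = n ∧
      ∃ c, ∀ u, RigidWord 0 k u → u.length = m → χ (wordSubst u w) = c := by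
  rcases m with _ | m
  · exact ⟨0, fun χ => ⟨[], .nil 0, rfl, χ [], fun u _ _ => rfl⟩⟩
  rcases k with _ | k
  · refine ⟨m + 1, fun χ => ⟨List.range' 0 (m + 1), ?_, by simp, χ [], fun u hu hm => ?_⟩⟩
    · simpa using RigidWord.range' 0 (m + 1)
    · rcases u with _ | ⟨x, u⟩
      · simp at hm
      · exact absurd (hu.lt_of_mem x (by simp)) (by omega)
  · obtain ⟨n, hn⟩ := grahamRothschild one_pos k m κ
    refine ⟨n + 1, fun χ => ?_⟩
    obtain ⟨w, hw, hl, c, hc⟩ := hn fun y => χ (0 :: y)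
    refine ⟨0 :: w, .new (by rwa [add_comm] at hw), by simp [hl], c, fun u hu hm => ?_⟩
    cases hu with
    | old hx => omega
    | @new _ _ u hu =>
      have : wordSubst (0 :: u) (0 :: w) = 0 :: paramSubst 1 u w := by
        simp [wordSubst, paramSubst]
      rw [this]
      exact hc u (by rw [add_comm 1 k]; exact hu) (by simpa using hm)

namespace RigidWord

lemma mem_take {a b : ℕ} {w : List ℕ} (h : RigidWord a b w) :
    ∀ (i : ℕ) (hi : i < w.length) (y : ℕ), a ≤ y → y < w[i] → y ∈ w.take i := by
  induction h with
  | nil => simp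
  | @old a b x w hx h ih =>
    rintro (_ | i) hi y hay hy
    · simp at hy; omega
    · simpa using .inr (ih i (by simpa using hi) y hay (by simpa using hy))
  | @new a b w h ih =>
    rintro (_ | i) hi y hay hy
    · simp at hy; omega
    · rcases hay.eq_or_lt with rfl | hay
      · simp
      · simpa using .inr (ih i (by simpa using hi) y hay (by simpa using hy))

lemma of_mem_take {a b : ℕ} {w : List ℕ} (hab : a ≤ b) (hlt : ∀ x ∈ w, x < b)
    (hmem : ∀ y, a ≤ y → y < b → y ∈ w)
    (h : ∀ (i : ℕ) (hi : i < w.length) (y : ℕ), a ≤ y → y < w[i] → y ∈ w.take i) :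
    RigidWord a b w := by
  induction w generalizing a with
  | nil =>
    obtain rfl : a = b := by
      by_contra hne
      simpa using hmem a le_rfl (by omega)
    exact .nil a
  | cons x w ih =>
    have hxa : x ≤ a := by
      by_contra hx
      simpa using h 0 (by simp) a le_rfl (by simpa using hx)
    have hlt' : ∀ y ∈ w, y < b := fun y hy => hlt y (by simp [hy])
    rcases hxa.eq_or_lt with rfl | hxa
    · refine .new (ih (hlt x (by simp)) hlt' (fun y hy hyb => ?_) fun i hi y hy hyi => ?_)
      · simpa [(Nat.lt_of_succ_le hy).ne'] using hmem y (by omega) hyb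
      · simpa [(Nat.lt_of_succ_le hy).ne'] using
          h (i + 1) (by simpa using hi) y (by omega) (by simpa using hyi)
    · refine .old hxa (ih hab hlt' (fun y hy hyb => ?_) fun i hi y hy hyi => ?_)
      · simpa [(hxa.trans_le hy).ne'] using hmem y hy hyb
      · simpa [(hxa.trans_le hy).ne'] using
          h (i + 1) (by simpa using hi) y hy (by simpa using hyi)

end RigidWord

/-- A surjection between orders is rigid if the first occurrences of its values are in
increasing order. -/
def IsRigidSurj {ι P : Type} [LT ι] [LT P] (f : ι → P) : Prop :=
  Function.Surjective f ∧ ∀ i, ∀ p < f i, ∃ j < i, f j = p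

lemma IsRigidSurj.comp {ι P Q : Type} [LT ι] [LT P] [LT Q] {g : P → Q} {f : ι → P}
    (hg : IsRigidSurj g) (hf : IsRigidSurj f) : IsRigidSurj (g ∘ f) := by
  refine ⟨hg.1.comp hf.1, fun i q hq => ?_⟩
  obtain ⟨p, hp, rfl⟩ := hg.2 _ q hq
  obtain ⟨j, hj, rfl⟩ := hf.2 i p hp
  exact ⟨j, hj, rfl⟩

theorem exists_mono_isRigidSurj (P Q : Type) [LinearOrder P] [LinearOrder Q] [Finite P] [Finite Q]
    [Nonempty P] (κ : Type) [Finite κ] : ∃ N, ∀ χ : (Fin N → P) → κ, ∃ w : Fin N → Q,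
      IsRigidSurj w ∧ ∃ c, ∀ h : Q → P, IsRigidSurj h → χ (h ∘ w) = c := by
  have := Fintype.ofFinite P
  have := Fintype.ofFinite Q
  let eP := Fintype.orderIsoFinOfCardEq P rfl
  let eQ := Fintype.orderIsoFinOfCardEq Q rfl
  let φ : ℕ → P := fun x => if h : x < Fintype.card P then eP ⟨x, h⟩ else Classical.arbitrary P
  obtain ⟨N, hN⟩ := dualRamsey (Fintype.card P) (Fintype.card Q) κ
  refine ⟨N, fun χ => ?_⟩
  obtain ⟨w, hw, hl, c, hc⟩ := hN fun y => χ fun i => φ (y.getD i 0)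
  subst hl
  have hwlt : ∀ i : Fin w.length, w[i] < Fintype.card Q :=
    fun i => hw.lt_of_mem _ (List.getElem_mem _)
  refine ⟨fun i => eQ ⟨w[i], hwlt i⟩, ⟨fun q => ?_, fun i q hq => ?_⟩, c, fun h hh => ?_⟩
  · obtain ⟨i, hi, hiq⟩ := List.getElem_of_mem (hw.mem (eQ.symm q) (Nat.zero_le _) (Fin.is_lt _))
    refine ⟨⟨i, hi⟩, ?_⟩
    rw [← OrderIso.eq_symm_apply]
    exact Fin.ext hiq
  · obtain ⟨x, rfl⟩ := eQ.surjective q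
    have hx : (x : ℕ) < w[i] := eQ.lt_iff_lt.mp hq
    obtain ⟨j, hj, hjx⟩ := List.mem_take_iff_getElem.mp (hw.mem_take i i.2 x (Nat.zero_le _) hx)
    refine ⟨⟨j, by omega⟩, Fin.lt_def.mpr (by simp; omega), ?_⟩
    exact congrArg eQ (Fin.ext hjx)
  · set u : List ℕ := List.ofFn fun j => (eP.symm (h (eQ j)) : ℕ) with hu
    have hul : u.length = Fintype.card Q := by simp [hu]
    have huw : RigidWord 0 (Fintype.card P) u := by
      refine RigidWord.of_mem_take (Nat.zero_le _) ?_ ?_ ?_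
      · intro x hx
        obtain ⟨j, rfl⟩ := (List.mem_ofFn' _ _).mp hx
        exact Fin.is_lt _
      · intro y _ hy
        obtain ⟨q, hq⟩ := hh.1 (eP ⟨y, hy⟩)
        exact (List.mem_ofFn' _ _).mpr ⟨eQ.symm q, by simp [hq]⟩
      · intro i hi y _ hy
        have hi' : i < Fintype.card Q := hul ▸ hi
        have hy' : y < (eP.symm (h (eQ ⟨i, hi'⟩)) : ℕ) := by simpa [hu] using hy
        obtain ⟨q, hq, hqy⟩ := hh.2 (eQ ⟨i, hi'⟩) (eP ⟨y, hy'.trans (Fin.is_lt _)⟩)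
          (by rw [← OrderIso.lt_symm_apply]; exact hy')
        have hqi : (eQ.symm q : ℕ) < i := by
          rw [← OrderIso.symm_apply_lt] at hq
          exact hq
        refine List.mem_take_iff_getElem.mpr ⟨eQ.symm q, by omega, ?_⟩
        simp [hu, hqy]
    rw [← hc u huw hul]
    congr 1
    funext i
    have : (wordSubst u w).getD i 0 = (eP.symm (h (eQ ⟨w[i], hwlt i⟩)) : ℕ) := by
      have hi := hwlt i
      simp only [Fin.getElem_fin] at hi
      simp [wordSubst, hu, hi]
    rw [this]
    simp [φ]

/-- The finite sets closed downwards under `r`, ordered colexicographically. -/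
abbrev LowerFinset {A : Type} (r : A → A → Prop) : Type :=
  {D : Colex (Finset A) // ∀ x y, r x y → y ∈ ofColex D → x ∈ ofColex D}

section LowerFinset

variable {A : Type} {r : A → A → Prop}

lemma LowerFinset.ext {D E : LowerFinset r} (h : ∀ x, x ∈ ofColex D.1 ↔ x ∈ ofColex E.1) :
    D = E :=
  Subtype.ext (ofColex.injective (Finset.ext h))

lemma LowerFinset.le_def [LinearOrder A] {D E : LowerFinset r} : D ≤ E ↔
    ∀ ⦃a⦄, a ∈ ofColex D.1 → a ∉ ofColex E.1 → ∃ b, b ∈ ofColex E.1 ∧ b ∉ ofColex D.1 ∧ a ≤ b :=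
  Iff.rfl

instance : Nonempty (LowerFinset r) := ⟨⟨toColex ∅, by simp⟩⟩

instance [Finite A] : Finite (LowerFinset r) :=
  .of_injective (fun D => ofColex D.1) fun _ _ h => Subtype.ext (ofColex_inj.mp h)

variable {B : Type} {s : B → B → Prop}

open Classical in
/-- The principal lower set generated by the image of `D` under `f`. -/
noncomputable def LowerFinset.image [Fintype B] [IsStrictOrder B s] (f : A → B) (D : Finset A) :
    LowerFinset s :=
  ⟨toColex (Finset.univ.filter fun y => ∃ x ∈ D, y = f x ∨ s y (f x)), by
    simp only [ofColex_toColex, Finset.mem_filter_univ]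
    rintro x y hxy ⟨z, hz, rfl | hyz⟩
    · exact ⟨z, hz, .inr hxy⟩
    · exact ⟨z, hz, .inr (trans_of s hxy hyz)⟩⟩

lemma LowerFinset.mem_image [Fintype B] [IsStrictOrder B s] {f : A → B} {D : Finset A} {y : B} :
    y ∈ ofColex (LowerFinset.image (s := s) f D).1 ↔ ∃ x ∈ D, y = f x ∨ s y (f x) := by
  simp [LowerFinset.image]

open Classical in
/-- The preimage of a lower set under an order preserving map. -/
noncomputable def LowerFinset.preimage [Fintype A] (f : A → B) (hr : ∀ x y, r x y → s (f x) (f y))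
    (E : LowerFinset s) : LowerFinset r :=
  ⟨toColex (Finset.univ.filter fun x => f x ∈ ofColex E.1), by
    simp only [ofColex_toColex, Finset.mem_filter_univ]
    exact fun x y hxy hy => E.2 _ _ (hr x y hxy) hy⟩

lemma LowerFinset.mem_preimage [Fintype A] {f : A → B} {hr : ∀ x y, r x y → s (f x) (f y)}
    {E : LowerFinset s} {x : A} :
    x ∈ ofColex (LowerFinset.preimage f hr E).1 ↔ f x ∈ ofColex E.1 := by
  simp [LowerFinset.preimage]

variable [LinearOrder A] [LinearOrder B] [Fintype A]

theorem LowerFinset.isRigidSurj_preimage [Fintype B] [IsStrictOrder B s] {f : A → B}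
    (hf : StrictMono f) (hr : ∀ x y, r x y ↔ s (f x) (f y)) (hs : ∀ x y, s x y → x < y) :
    IsRigidSurj (LowerFinset.preimage (r := r) (s := s) f fun x y => (hr x y).1) := by
  have hpre : ∀ D : LowerFinset r,
      LowerFinset.preimage f (fun x y => (hr x y).1)
        (LowerFinset.image (s := s) f (ofColex D.1)) = D := by
    refine fun D => LowerFinset.ext fun x => ?_
    rw [mem_preimage, mem_image]
    constructor
    · rintro ⟨z, hz, h | h⟩
      · rwa [hf.injective h]
      · exact D.2 _ _ ((hr x z).2 h) hz
    · exact fun h => ⟨x, h, .inl rfl⟩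
  refine ⟨fun D => ⟨_, hpre D⟩, fun E D hD => ⟨_, lt_of_le_of_ne ?_ ?_, hpre D⟩⟩
  · intro y hy hyE
    obtain ⟨d, hd, hyd⟩ := mem_image.mp hy
    have hdE : f d ∉ ofColex E.1 := by
      rcases hyd with rfl | hyd
      · exact hyE
      · exact fun h => hyE (E.2 _ _ hyd h)
    obtain ⟨b, hb, hbD, hdb⟩ := LowerFinset.le_def.mp hD.le hd (mt mem_preimage.mp hdE)
    refine ⟨f b, mem_preimage.mp hb, fun h => hbD ?_, ?_⟩
    · rw [← hpre D]
      exact mem_preimage.mpr h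
    · have : y ≤ f d := hyd.elim le_of_eq fun h => (hs _ _ h).le
      exact this.trans (hf.monotone hdb)
  · rintro rfl
    exact hD.ne (hpre D).symm

/-- The embedding into a cube given by a sequence of lower sets. -/
def cubeMap {N : ℕ} (D : Fin N → LowerFinset r) (a : A) : Fin N → Prop :=
  fun i => a ∉ ofColex (D i).1

variable {N : ℕ} {D : Fin N → LowerFinset r}

lemma toLex_cubeMap_strictMono [IsStrictOrder A r] (hr : ∀ x y, r x y → x < y)
    (hD : IsRigidSurj D) : StrictMono fun a => toLex (cubeMap D a) := by
  classical
  intro a b hab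
  let E : LowerFinset r := LowerFinset.image id {a}
  have hE : ∀ x, x ∈ ofColex E.1 ↔ x = a ∨ r x a := by simp [E, LowerFinset.mem_image]
  have haE : a ∈ ofColex E.1 := (hE a).2 (.inl rfl)
  have hbE : b ∉ ofColex E.1 := by
    rw [hE]
    rintro (rfl | h)
    · exact hab.ne rfl
    · exact hab.asymm (hr _ _ h)
  have hex : ∃ i, ¬(a ∈ ofColex (D i).1 ↔ b ∈ ofColex (D i).1) := by
    obtain ⟨i, hi⟩ := hD.1 E
    exact ⟨i, by simp [hi, haE, hbE]⟩
  obtain ⟨i, hi, hmin⟩ := WellFounded.has_min (wellFounded_lt (α := Fin N)) _ hex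
  refine ⟨i, fun j hj => ?_, ?_⟩
  · have : a ∈ ofColex (D j).1 ↔ b ∈ ofColex (D j).1 := by
      by_contra h
      exact hmin j h hj
    simp [cubeMap, this]
  · by_cases ha : a ∈ ofColex (D i).1
    · have hb : b ∉ ofColex (D i).1 := fun hb => hi (by simp [ha, hb])
      simpa [cubeMap, ha, hb] using (bot_lt_top : (⊥ : Prop) < ⊤)
    · have hb : b ∈ ofColex (D i).1 := by
        by_contra hb
        exact hi (by simp [ha, hb])
      have hlt : E < D i := by
        refine lt_of_le_of_ne (fun x hx _ => ⟨b, hb, hbE, ?_⟩) ?_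
        · rcases (hE x).1 hx with rfl | h
          · exact hab.le
          · exact ((hr _ _ h).trans hab).le
        · intro h
          exact ha (h ▸ haE)
      obtain ⟨j, hj, hjE⟩ := hD.2 i E hlt
      exact absurd hj (hmin j (by simp [hjE, haE, hbE] : ¬ _))

lemma cubeMap_injective [IsStrictOrder A r] (hr : ∀ x y, r x y → x < y) (hD : IsRigidSurj D) :
    Function.Injective (cubeMap D) :=
  fun _ _ h => (toLex_cubeMap_strictMono hr hD).injective (congrArg toLex h)

lemma cubeMap_lt_cubeMap [IsStrictOrder A r] (hr : ∀ x y, r x y → x < y) (hD : IsRigidSurj D)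
    (a b : A) : r a b ↔ cubeMap D a < cubeMap D b := by
  constructor
  · intro h
    refine lt_of_le_of_ne (fun i ha hb => ha ((D i).2 _ _ h hb)) fun heq => ?_
    exact (hr _ _ h).ne (cubeMap_injective hr hD heq)
  · intro h
    obtain ⟨i, hi⟩ := hD.1 (LowerFinset.image id {b})
    have hmem : ∀ x, x ∈ ofColex (D i).1 ↔ x = b ∨ r x b := by
      simp [hi, LowerFinset.mem_image]
    have ha : a ∈ ofColex (D i).1 := by
      by_contra ha
      exact h.le i ha ((hmem b).2 (.inl rfl))
    rcases (hmem a).1 ha with rfl | hab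
    · exact absurd rfl h.ne
    · exact hab

end LowerFinset

/-- The class of finite posets with a linear extension. -/
def linExtPosets : Set (BinStr (Fin 2)) :=
  {A | Finite A.carrier ∧ IsStrictOrder A.carrier (A.rel 0) ∧
    IsStrictTotalOrder A.carrier (A.rel 1) ∧ ∀ x y : A.carrier, A.rel 0 x y → A.rel 1 x y}

/-- The cube with the product order and the lexicographic order. -/
def cube (N : ℕ) : BinStr (Fin 2) where
  carrier := Fin N → Prop
  rel := ![fun x y => x < y, fun x y => toLex x < toLex y]

lemma cube_mem_linExtPosets (N : ℕ) : cube N ∈ linExtPosets := by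
  refine ⟨inferInstanceAs (Finite (Fin N → Prop)),
    inferInstanceAs (IsStrictOrder (Fin N → Prop) (· < ·)),
    inferInstanceAs (IsStrictTotalOrder (Lex (Fin N → Prop)) (· < ·)), fun x y h => ?_⟩
  exact Pi.toLex_strictMono h

lemma BinEmb.ext_toFun {ι : Type} {A B : BinStr ι} {f g : BinEmb A B}
    (h : ∀ x, f.toFun x = g.toFun x) : f = g := by
  obtain ⟨f, _, _⟩ := f
  obtain ⟨g, _, _⟩ := g
  obtain rfl : f = g := funext h
  rfl

/-- The embedding of a poset with a linear extension into a cube given by a rigid surjection onto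
its lower sets. -/
def cubeEmb {A : BinStr (Fin 2)} [LinearOrder A.carrier] [Fintype A.carrier]
    [IsStrictOrder A.carrier (A.rel 0)] (h₁ : ∀ x y, A.rel 1 x y ↔ x < y)
    (h₀ : ∀ x y, A.rel 0 x y → x < y) {N : ℕ} (D : Fin N → LowerFinset (A.rel 0))
    (hD : IsRigidSurj D) : BinEmb A (cube N) where
  toFun := cubeMap D
  inj := cubeMap_injective h₀ hD
  map_rel := Fin.forall_fin_two.2 ⟨fun x y => cubeMap_lt_cubeMap h₀ hD x y,
    fun x y => (h₁ x y).trans (toLex_cubeMap_strictMono h₀ hD).lt_iff_lt.symm⟩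

theorem binRamseyClass_linExtPosets : BinRamseyClass linExtPosets := by
  classical
  rintro A ⟨hA, hA₀, hA₁, hA⟩ B ⟨hB, hB₀, hB₁, hB⟩ r
  have := Fintype.ofFinite A.carrier
  have := Fintype.ofFinite B.carrier
  let : LinearOrder A.carrier := linearOrderOfSTO (A.rel 1)
  let : LinearOrder B.carrier := linearOrderOfSTO (B.rel 1)
  have hltA : ∀ x y, A.rel 1 x y ↔ x < y := fun _ _ => Iff.rfl
  have hltB : ∀ x y, B.rel 1 x y ↔ x < y := fun _ _ => Iff.rfl
  obtain ⟨N, hN⟩ := exists_mono_isRigidSurj (LowerFinset (A.rel 0)) (LowerFinset (B.rel 0))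
    (Option (Fin r))
  refine ⟨cube N, cube_mem_linExtPosets N, fun χ => ?_⟩
  obtain ⟨w, hw, c, hc⟩ := hN fun D =>
    if h : IsRigidSurj D then some (χ (cubeEmb hltA hA D h)) else none
  refine ⟨cubeEmb hltB hB w hw, fun f₁ f₂ => ?_⟩
  have key : ∀ f : BinEmb A B, some (χ ((cubeEmb hltB hB w hw).comp f)) = c := by
    intro f
    have hf : IsRigidSurj (LowerFinset.preimage f.toFun fun x y => (f.map_rel 0 x y).1) :=
      LowerFinset.isRigidSurj_preimage (fun x y h => (f.map_rel 1 x y).1 h) (f.map_rel 0) hB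
    have hcomp := hf.comp hw
    rw [← hc _ hf, dif_pos hcomp]
    congr 2
    refine BinEmb.ext_toFun fun x => ?_
    funext i
    exact propext (not_congr LowerFinset.mem_preimage.symm)
  exact Option.some.inj ((key f₁).trans (key f₂).symm)

instance {ι : Type} (A B : BinStr ι) [Finite A.carrier] [Finite B.carrier] :
    Finite (BinEmb A B) :=
  Finite.of_injective BinEmb.toFun fun _ _ h => BinEmb.ext_toFun (congrFun h)

/-- The product Ramsey theorem for a Ramsey class of finite structures. -/
theorem BinRamseyClass.prod {ι : Type} {K : Set (BinStr ι)} (hK : BinRamseyClass K)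
    (hfin : ∀ A ∈ K, Finite A.carrier) {A₁ B₁ A₂ B₂ : BinStr ι} (hA₁ : A₁ ∈ K) (hB₁ : B₁ ∈ K)
    (hA₂ : A₂ ∈ K) (hB₂ : B₂ ∈ K) (r : ℕ) : ∃ C₁ ∈ K, ∃ C₂ ∈ K,
      ∀ χ : BinEmb A₁ C₁ → BinEmb A₂ C₂ → Fin r, ∃ (g₁ : BinEmb B₁ C₁) (g₂ : BinEmb B₂ C₂),
        ∀ (f₁ f₁' : BinEmb A₁ B₁) (f₂ f₂' : BinEmb A₂ B₂),
          χ (g₁.comp f₁) (g₂.comp f₂) = χ (g₁.comp f₁') (g₂.comp f₂') := by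
  classical
  obtain ⟨C₂, hC₂, h₂⟩ := hK A₂ hA₂ B₂ hB₂ (r + 1)
  have := hfin A₂ hA₂
  have := hfin C₂ hC₂
  obtain ⟨n, ⟨e⟩⟩ := Finite.exists_equiv_fin (BinEmb A₂ C₂ → Fin r)
  obtain ⟨C₁, hC₁, h₁⟩ := hK A₁ hA₁ B₁ hB₁ n
  refine ⟨C₁, hC₁, C₂, hC₂, fun χ => ?_⟩
  obtain ⟨g₁, hg₁⟩ := h₁ fun f => e (χ f)
  obtain ⟨g₂, hg₂⟩ := h₂ fun f =>
    if h : Nonempty (BinEmb A₁ B₁) then (χ (g₁.comp h.some) f).castSucc else 0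
  refine ⟨g₁, g₂, fun f₁ f₁' f₂ f₂' => ?_⟩
  have h : Nonempty (BinEmb A₁ B₁) := ⟨f₁⟩
  have h2 := hg₂ f₂ f₂'
  simp only [dif_pos h, Fin.castSucc_inj] at h2
  rw [e.injective (hg₁ f₁ h.some), h2, e.injective (hg₁ h.some f₁')]

/-- The structure on the carrier of `A` given by the relations indexed through `σ`. -/
def BinStr.reduct {ι κ : Type} (σ : κ → ι) (A : BinStr ι) : BinStr κ where
  carrier := A.carrier
  rel k := A.rel (σ k)

/-- An embedding is also an embedding of reducts. -/
def BinEmb.reduct {ι κ : Type} (σ : κ → ι) {A B : BinStr ι} (f : BinEmb A B) :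
    BinEmb (A.reduct σ) (B.reduct σ) where
  toFun := f.toFun
  inj := f.inj
  map_rel k := f.map_rel (σ k)

/-- The product of two posets with linear extensions, ordered by the partial order of the first
factor and by the two lexicographic orders. -/
def superposition (C₁ C₂ : BinStr (Fin 2)) : BinStr (Fin 3) where
  carrier := C₁.carrier × C₂.carrier
  rel := ![fun x y => C₁.rel 0 x.1 y.1, Prod.Lex (C₁.rel 1) (C₂.rel 1),
    fun x y => Prod.Lex (C₂.rel 1) (C₁.rel 1) x.swap y.swap]

lemma prodLex_iff_of_injective {X Y Z : Type} {r : Y → Y → Prop} {s : Z → Z → Prop}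
    [Std.Irrefl s] {f : X → Y} (hf : Function.Injective f) (g : X → Z) (x y : X) :
    Prod.Lex r s (f x, g x) (f y, g y) ↔ r (f x) (f y) := by
  rw [Prod.lex_def]
  refine or_iff_left ?_
  rintro ⟨h, h'⟩
  cases hf h
  exact irrefl_of s _ h'

/-- Two embeddings of reducts give an embedding into the superposition. -/
def BinEmb.superpose {A : BinStr (Fin 3)} {C₁ C₂ : BinStr (Fin 2)}
    [Std.Irrefl (C₁.rel 1)] [Std.Irrefl (C₂.rel 1)]
    (e₁ : BinEmb (A.reduct ![0, 1]) C₁) (e₂ : BinEmb (A.reduct ![2, 2]) C₂) :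
    BinEmb A (superposition C₁ C₂) where
  toFun x := (e₁.toFun x, e₂.toFun x)
  inj _ _ h := e₁.inj (congrArg Prod.fst h)
  map_rel i x y := by
    fin_cases i
    · exact e₁.map_rel 0 x y
    · exact (e₁.map_rel 1 x y).trans (prodLex_iff_of_injective e₁.inj e₂.toFun x y).symm
    · exact (e₂.map_rel 1 x y).trans (prodLex_iff_of_injective e₂.inj e₁.toFun x y).symm

lemma isStrictTotalOrder_prodLex {X Y : Type} (r : X → X → Prop) (s : Y → Y → Prop)
    [IsStrictTotalOrder X r] [IsStrictTotalOrder Y s] :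
    IsStrictTotalOrder (X × Y) (Prod.Lex r s) where

/-- The class of all finite structures `(X, ≺, <₁, <₂)`, where `≺` (index 0) is a strict
partial order, `<₁` (index 1) is a strict linear order extending `≺`, and `<₂` (index 2) is an
arbitrary strict linear order, has the Ramsey property. -/
theorem statement5 :
    BinRamseyClass {A : BinStr (Fin 3) |
      Finite A.carrier ∧
        IsStrictOrder A.carrier (A.rel 0) ∧
        IsStrictTotalOrder A.carrier (A.rel 1) ∧
        (∀ x y : A.carrier, A.rel 0 x y → A.rel 1 x y) ∧
        IsStrictTotalOrder A.carrier (A.rel 2)} := by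
  rintro A ⟨hA, hA₀, hA₁, hA₀₁, hA₂⟩ B ⟨hB, hB₀, hB₁, hB₀₁, hB₂⟩ r
  obtain ⟨C₁, ⟨hC₁, hC₁₀, hC₁₁, hC₁₀₁⟩, C₂, ⟨hC₂, -, hC₂₁, -⟩, h⟩ :=
    binRamseyClass_linExtPosets.prod (fun _ h => h.1)
      (A₁ := A.reduct ![0, 1]) (B₁ := B.reduct ![0, 1])
      (A₂ := A.reduct ![2, 2]) (B₂ := B.reduct ![2, 2])
      ⟨hA, hA₀, hA₁, hA₀₁⟩ ⟨hB, hB₀, hB₁, hB₀₁⟩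
      ⟨hA, hA₂.toIsStrictOrder, hA₂, fun _ _ => id⟩
      ⟨hB, hB₂.toIsStrictOrder, hB₂, fun _ _ => id⟩ r
  refine ⟨superposition C₁ C₂, ⟨inferInstanceAs (Finite (C₁.carrier × C₂.carrier)), ?_,
    isStrictTotalOrder_prodLex (C₁.rel 1) (C₂.rel 1),
    fun x y hxy => Prod.lex_def.2 (.inl (hC₁₀₁ _ _ hxy)), ?_⟩, fun χ => ?_⟩
  · exact { irrefl := fun x => irrefl_of (C₁.rel 0) x.1
            trans := fun _ _ _ => trans_of (C₁.rel 0) }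
  · have := isStrictTotalOrder_prodLex (C₂.rel 1) (C₁.rel 1)
    exact (RelIso.preimage (Equiv.prodComm C₁.carrier C₂.carrier)
      (Prod.Lex (C₂.rel 1) (C₁.rel 1))).toRelEmbedding.isStrictTotalOrder
  · obtain ⟨g₁, g₂, hg⟩ := h fun e₁ e₂ => χ (e₁.superpose e₂)
    exact ⟨g₁.superpose g₂, fun f₁ f₂ => hg (f₁.reduct _) (f₂.reduct _) (f₁.reduct _) (f₂.reduct _)⟩
end

section
/- The class of all finite structures (X, ≺₁, <₁, ≺₂, <₂), where ≺₁ and ≺₂ are strict partial orders, <₁ is a strict linear order extending ≺₁, and <₂ is a strict linear order extending ≺₂, has the Ramsey property: for all A, B in this class and all r ∈ ℕ there exists C in this class such that every coloring χ : Emb(A,C) → Fin r is constant on {g ∘ f : f ∈ Emb(A,B)} for some g ∈ Emb(B,C). -/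
/-- Parameter words of length `n` over the alphabet `α` with `k` parameters, each of which occurs,
the first occurrences being in increasing order. The constructor `var` introduces the first
parameter, which is a letter (`none`) of the alphabet of the rest of the word. -/
inductive ParamWord : Type → ℕ → ℕ → Type 1
  | nil {α : Type} : ParamWord α 0 0
  | cons {α : Type} {n k : ℕ} (a : α) (w : ParamWord α n k) : ParamWord α (n + 1) k
  | var {α : Type} {n k : ℕ} (w : ParamWord (Option α) n k) : ParamWord α (n + 1) (k + 1)

namespace ParamWord

variable {α β γ S : Type} {n m k l : ℕ}

/-- Substitute `T` for the parameters of a word and `s` for its letters, stopping at the first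
parameter for which `T` has no entry. -/
def eval : {α : Type} → {n k : ℕ} → (α → S) → ParamWord α n k → List S → List S
  | _, _, _, _, nil, _ => []
  | _, _, _, s, cons a w, T => s a :: eval s w T
  | _, _, _, _, var _, [] => []
  | _, _, _, s, var w, t :: T => t :: eval (fun o => o.elim t s) w T

/-- Substitute the word `v` for the parameters of `w`, and `s` for the letters of `w`. -/
def comp : {α β : Type} → {n m k : ℕ} → (α → β) → ParamWord α n m → ParamWord β m k →
    ParamWord β n k
  | _, _, _, _, _, _, nil, nil => nil
  | _, _, _, _, _, s, cons a w, v => cons (s a) (comp s w v)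
  | _, _, _, _, _, s, var w, cons b v => cons b (comp (fun o => o.elim b s) w v)
  | _, _, _, _, _, s, var w, var v => var (comp (Option.map s) w v)

/-- Replace the letters of a word. -/
def map : {α β : Type} → {n k : ℕ} → (α → β) → ParamWord α n k → ParamWord β n k
  | _, _, _, _, _, nil => nil
  | _, _, _, _, s, cons a w => cons (s a) (map s w)
  | _, _, _, _, s, var w => var (map (Option.map s) w)

/-- Append a new parameter at the end of a word. -/
def snocVar : {α : Type} → {n k : ℕ} → ParamWord α n k → ParamWord α (n + 1) (k + 1)
  | _, _, _, nil => var nil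
  | _, _, _, cons a w => cons a (snocVar w)
  | _, _, _, var w => var (snocVar w)

/-- The parameter word without parameters spelled by a list, padded to length `n`. -/
def ofList [Inhabited α] : (n : ℕ) → List α → ParamWord α n 0
  | 0, _ => nil
  | n + 1, [] => cons default (ofList n [])
  | n + 1, a :: u => cons a (ofList n u)

/-- Prepend a list of letters to a word. -/
def prepend (w : ParamWord α n k) : (u : List α) → ParamWord α (n + u.length) k
  | [] => w
  | a :: u => cons a (prepend w u)

theorem comp_elim (t : β → γ) (s : α → β) (b : β) :
    (t ∘ fun o : Option α => o.elim b s) = fun o => o.elim (t b) (t ∘ s) := by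
  funext o; cases o <;> rfl

theorem elim_comp_map (t : β → γ) (s : α → β) (c : γ) :
    ((fun o : Option β => o.elim c t) ∘ Option.map s) = fun o => o.elim c (t ∘ s) := by
  funext o; cases o <;> rfl

theorem eval_comp (w : ParamWord α n m) : ∀ {β : Type} {k : ℕ} (s : α → β) (v : ParamWord β m k)
    (t : β → S) (T : List S), eval t (comp s w v) T = eval (t ∘ s) w (eval t v T) := by
  induction w with
  | nil => intro β k s v t T; cases v; rfl
  | cons a w ih => intro β k s v t T; simp [comp, eval, ih]
  | var w ih =>
    intro β k s v t T
    cases v with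
    | cons b v => simp [comp, eval, ih, comp_elim]
    | var v => cases T <;> simp [comp, eval, ih, elim_comp_map]

theorem comp_comp (w : ParamWord α n m) : ∀ {β γ : Type} {k l : ℕ} (s : α → β)
    (v : ParamWord β m k) (t : β → γ) (u : ParamWord γ k l),
    comp t (comp s w v) u = comp (t ∘ s) w (comp t v u) := by
  induction w with
  | nil => intro β γ k l s v t u; cases v; cases u; rfl
  | cons a w ih => intro β γ k l s v t u; simp [comp, ih]
  | var w ih =>
    intro β γ k l s v t u
    cases v with
    | cons b v => simp [comp, ih, comp_elim]
    | var v => cases u <;> simp [comp, ih, elim_comp_map]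

theorem comp_map (w : ParamWord α n m) : ∀ {β γ : Type} {k : ℕ} (s : α → β) (t : β → γ)
    (u : ParamWord γ m k), comp t (map s w) u = comp (t ∘ s) w u := by
  induction w with
  | nil => intro β γ k s t u; cases u; rfl
  | cons a w ih => intro β γ k s t u; simp [comp, map, ih]
  | var w ih => intro β γ k s t u; cases u <;> simp [comp, map, ih, elim_comp_map]

theorem eval_map (w : ParamWord α n m) : ∀ {β : Type} (s : α → β) (t : β → S) (T : List S),
    eval t (map s w) T = eval (t ∘ s) w T := by
  induction w with
  | nil => intros; rfl
  | cons a w ih => intro β s t T; simp [eval, map, ih]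
  | var w ih => intro β s t T; cases T <;> simp [eval, map, ih, elim_comp_map]

theorem map_eval {S' : Type} (f : S → S') (w : ParamWord α n m) : ∀ (s : α → S) (T : List S),
    (eval s w T).map f = eval (f ∘ s) w (T.map f) := by
  induction w with
  | nil => intros; rfl
  | cons a w ih => intro s T; simp [eval, ih]
  | var w ih => intro s T; cases T <;> simp [eval, ih, comp_elim]

theorem length_eval (w : ParamWord α n k) : ∀ (s : α → S) (T : List S), T.length = k →
    (eval s w T).length = n := by
  induction w with
  | nil => intros; rfl
  | cons a w ih => intro s T h; simp [eval, ih _ _ h]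
  | var w ih =>
    intro s T h
    cases T with
    | nil => simp at h
    | cons t T => simp [eval, ih _ T (by simpa using h)]

theorem eval_snocVar (w : ParamWord α n k) : ∀ (s : α → S) (T : List S), T.length ≤ k →
    eval s (snocVar w) T = eval s w T := by
  induction w with
  | nil => intro s T h; cases T <;> simp_all [snocVar, eval]
  | cons a w ih => intro s T h; simp [snocVar, eval, ih _ _ h]
  | var w ih =>
    intro s T h
    cases T with
    | nil => simp [snocVar, eval]
    | cons t T => simp [snocVar, eval, ih _ T (by simpa using h)]

theorem length_eval_nil_lt (w : ParamWord α n (k + 1)) (s : α → S) :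
    (eval s w []).length < n := by
  generalize h : k + 1 = j at w
  induction w generalizing k with
  | nil => simp at h
  | cons a w ih => simpa [eval] using ih s h
  | var w ih => simp [eval]

theorem ofList_eval [Inhabited α] (w : ParamWord α n 0) : ofList n (eval id w []) = w := by
  induction n with
  | zero => cases w; rfl
  | succ n ih => cases w with | cons a w => simp [eval, ofList, ih]

theorem eval_prepend (w : ParamWord α n k) (u : List α) (s : α → S) (T : List S) :
    eval s (prepend w u) T = u.map s ++ eval s w T := by
  induction u with
  | nil => rfl
  | cons a u ih => simp [prepend, eval, ih]

theorem exists_eval_line_append (w : ParamWord α n k) (u : List (Option α)) (hu : none ∈ u)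
    (hl : u.length = l) : ∃ v : ParamWord α (n + l) (k + 1), ∀ a T,
      eval id v (a :: T) = u.map (fun o => o.getD a) ++ eval id w T := by
  subst hl
  induction u with
  | nil => simp at hu
  | cons o u ih =>
    cases o with
    | none =>
      refine ⟨var (prepend (map some w) u), fun a T => ?_⟩
      simp only [eval, eval_prepend, eval_map, List.map_cons, Option.getD_none, List.cons_append]
      congr 2
      exact List.map_congr_left fun o _ => by cases o <;> rfl
    | some b =>
      obtain ⟨v, hv⟩ := ih (by simpa using hu)
      exact ⟨cons b v, fun a T => by simp [eval, hv]⟩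

/-- The multidimensional Hales-Jewett theorem, with ordered parameters. -/
theorem exists_mono_eval (α : Type) [Finite α] [Nonempty α] (κ : Type) [Finite κ] (m : ℕ) :
    ∃ n, ∀ c : List α → κ, ∃ w : ParamWord α n m, ∃ d, ∀ u : List α, u.length = m →
      c (eval id w u) = d := by
  induction m with
  | zero => exact ⟨0, fun c => ⟨nil, c [], fun u _ => rfl⟩⟩
  | succ m ih =>
    obtain ⟨n, hn⟩ := ih
    obtain ⟨ι, _, hι⟩ :=
      Combinatorics.Line.exists_mono_in_high_dimension α ((Fin n → α) → κ)
    let e := (Fintype.equivFin ι).symm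
    refine ⟨n + Fintype.card ι, fun c => ?_⟩
    obtain ⟨l, d, hd⟩ := hι fun x y => c (List.ofFn (x ∘ e) ++ List.ofFn y)
    let a₀ : α := Classical.arbitrary α
    obtain ⟨w, d', hw⟩ := hn fun u => d fun i => u.getD i a₀
    obtain ⟨v, hv⟩ := exists_eval_line_append w (List.ofFn (l.idxFun ∘ e)) (by
      obtain ⟨i, hi⟩ := l.proper
      exact (List.mem_ofFn' _ _).2 ⟨e.symm i, by simp [hi]⟩) List.length_ofFn
    refine ⟨v, d', fun u hu => ?_⟩
    cases u with
    | nil => simp at hu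
    | cons a u =>
      have hu : u.length = m := by simpa using hu
      rw [hv, ← hw u hu, ← hd a]
      congr 2
      · rw [List.map_ofFn]; rfl
      · apply List.ext_getElem <;> simp [length_eval, hu]

/-- A colouring of the words of all lengths depends only on the length after restriction to a
parameter word. -/
theorem exists_eval_eq_length (α : Type) [Finite α] [Nonempty α] (κ : Type) [Finite κ] [Nonempty κ]
    (m : ℕ) : ∃ n, ∀ c : List α → κ, ∃ w : ParamWord α n m, ∃ d : ℕ → κ,
      ∀ u : List α, u.length < m → c (eval id w u) = d u.length := by
  induction m with
  | zero => exact ⟨0, fun c => ⟨nil, fun _ => Classical.arbitrary κ, fun u h => by simp at h⟩⟩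
  | succ m ih =>
    obtain ⟨n, hn⟩ := ih
    obtain ⟨N, hN⟩ := exists_mono_eval α κ n
    refine ⟨N + 1, fun c => ?_⟩
    obtain ⟨v, d₀, hv⟩ := hN c
    obtain ⟨w, d, hw⟩ := hn fun u => c (eval id v u)
    refine ⟨snocVar (comp id v w), fun i => if i < m then d i else d₀, fun u hu => ?_⟩
    rw [eval_snocVar _ _ _ (by omega), eval_comp]
    dsimp only
    split_ifs with h
    · exact hw u h
    · exact hv _ (length_eval _ _ _ (by omega))

theorem nonempty_of_le (α : Type) [Nonempty α] (h : k ≤ n) : Nonempty (ParamWord α n k) := by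
  induction n generalizing α k with
  | zero => obtain rfl : k = 0 := by omega
            exact ⟨nil⟩
  | succ n ih =>
    cases k with
    | zero => exact (ih α (Nat.zero_le n)).map (cons (Classical.arbitrary α))
    | succ k => exact (ih (Option α) (by omega)).map var

theorem exists_length_eval (α : Type) [Nonempty α] (p : ℕ → Prop) [DecidablePred p]
    (h : m ≤ Nat.count p n) : ∃ w : ParamWord α n m, ∀ u : List α, u.length < m →
      p (eval id w u).length := by
  induction n generalizing α p m with
  | zero =>
    obtain rfl : m = 0 := by simpa using h
    exact ⟨nil, fun u hu => by simp at hu⟩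
  | succ n ih =>
    rw [Nat.count_succ'] at h
    by_cases h0 : p 0
    · cases m with
      | zero => exact (nonempty_of_le α (Nat.zero_le _)).elim fun w => ⟨w, fun u hu => by simp at hu⟩
      | succ m =>
        obtain ⟨w, hw⟩ := ih α (fun i => p (i + 1)) (m := m) (by simpa [h0] using h)
        refine ⟨var (map some w), fun u hu => ?_⟩
        cases u with
        | nil => simpa [eval] using h0
        | cons a u =>
          simp only [eval, eval_map, List.length_cons]
          exact hw u (by simpa using hu)
    · obtain ⟨w, hw⟩ := ih α (fun i => p (i + 1)) (m := m) (by simpa [h0] using h)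
      exact ⟨cons (Classical.arbitrary α) w, fun u hu => by simpa [eval] using hw u hu⟩

theorem exists_mono_eval_lt (α : Type) [Finite α] [Nonempty α] (κ : Type) [Finite κ] [Nonempty κ]
    (m : ℕ) : ∃ n, ∀ c : List α → κ, ∃ w : ParamWord α n m, ∃ d,
      ∀ u : List α, u.length < m → c (eval id w u) = d := by
  classical
  have := Fintype.ofFinite κ
  obtain ⟨n, hn⟩ := exists_eval_eq_length α κ (Fintype.card κ * m)
  refine ⟨n, fun c => ?_⟩
  obtain ⟨w, d, hw⟩ := hn c
  obtain ⟨a, -, ha⟩ := Finset.exists_le_card_fiber_of_mul_le_card_of_maps_to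
    (s := Finset.range (Fintype.card κ * m)) (t := Finset.univ) (f := d) (n := m)
    (fun _ _ => Finset.mem_univ _) Finset.univ_nonempty (by simp)
  obtain ⟨v, hv⟩ := exists_length_eval α (fun i => i < Fintype.card κ * m ∧ d i = a) (m := m)
    (n := Fintype.card κ * m) (ha.trans_eq (by
      rw [Nat.count_eq_card_filter_range]
      congr 1
      ext i
      simp))
  refine ⟨comp id w v, a, fun u hu => ?_⟩
  rw [eval_comp, ← (hv u hu).2]
  exact hw _ (hv u hu).1

/-- Assuming the Graham-Rothschild theorem for `k` parameters, a colouring of the words with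
`k + 1` parameters depends only on the letters preceding the first parameter, after restriction
to a parameter word. -/
theorem exists_comp_eq_eval_nil
    (hk : ∀ (α : Type) [Finite α] [Nonempty α] (κ : Type) [Finite κ] [Nonempty κ] (m : ℕ),
      ∃ n, ∀ c : ParamWord α n k → κ, ∃ w : ParamWord α n m, ∃ d, ∀ v : ParamWord α m k,
        c (comp id w v) = d)
    (α : Type) [Finite α] [Nonempty α] (m : ℕ) (κ : Type) [Finite κ] [Nonempty κ] :
    ∃ n, ∀ c : ParamWord α n (k + 1) → κ, ∃ w : ParamWord α n m, ∃ d : List α → κ,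
      ∀ v : ParamWord α m (k + 1), c (comp id w v) = d (eval id v []) := by
  induction m generalizing κ with
  | zero => exact ⟨0, fun c => ⟨nil, fun _ => Classical.arbitrary κ, fun v => nomatch v⟩⟩
  | succ m ih =>
    obtain ⟨n, hn⟩ := ih (α → κ)
    obtain ⟨N, hN⟩ := hk (Option α) κ n
    refine ⟨N + 1, fun c => ?_⟩
    obtain ⟨V, d₀, hV⟩ := hN fun v => c (var v)
    obtain ⟨W, d, hW⟩ := hn fun t a => c (cons a (comp (fun o => o.elim a id) V t))
    refine ⟨var (comp id V (map some W)),
      fun u => u.casesOn d₀ fun a u => d u a, fun v => ?_⟩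
    cases v with
    | var v =>
      simp only [comp, eval, comp_comp, comp_map, Option.map_id, Function.id_comp, Function.comp_id]
      exact hV _
    | cons a v =>
      simp only [comp, eval, comp_comp, comp_map, Function.comp_id]
      exact congrFun (hW v) a

/-- The **Graham-Rothschild theorem**. -/
theorem exists_mono_comp (k : ℕ) : ∀ (α : Type) [Finite α] [Nonempty α] (κ : Type) [Finite κ]
    [Nonempty κ] (m : ℕ), ∃ n, ∀ c : ParamWord α n k → κ, ∃ w : ParamWord α n m, ∃ d,
      ∀ v : ParamWord α m k, c (comp id w v) = d := by
  induction k with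
  | zero =>
    intro α _ _ κ _ _ m
    have : Inhabited α := Classical.inhabited_of_nonempty ‹_›
    obtain ⟨n, hn⟩ := exists_mono_eval α κ m
    refine ⟨n, fun c => ?_⟩
    obtain ⟨w, d, hw⟩ := hn fun u => c (ofList n u)
    refine ⟨w, d, fun v => ?_⟩
    rw [← ofList_eval (comp id w v), eval_comp]
    exact hw _ (length_eval _ _ _ rfl)
  | succ k ih =>
    intro α _ _ κ _ _ m
    obtain ⟨N, hN⟩ := exists_mono_eval_lt α κ m
    obtain ⟨n, hn⟩ := exists_comp_eq_eval_nil ih α N κ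
    refine ⟨n, fun c => ?_⟩
    obtain ⟨W, d, hW⟩ := hn c
    obtain ⟨V, d', hV⟩ := hN d
    refine ⟨comp id W V, d', fun v => ?_⟩
    rw [comp_comp, Function.comp_id, hW, eval_comp]
    exact hV _ (length_eval_nil_lt _ _)

theorem find?_eval (q : S → Bool) (w : ParamWord α n k) : ∀ (s : α → S) (T : List S),
    T.length = k → (∀ a, q (s a) = false) → (eval s w T).find? q = T.find? q := by
  induction w with
  | nil => intro s T h _; simp_all [eval]
  | cons a w ih => intro s T h hs; simp [eval, hs, ih _ T h hs]
  | var w ih =>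
    intro s T h hs
    cases T with
    | nil => simp at h
    | cons t T =>
      cases hq : q t with
      | true => simp [eval, hq]
      | false =>
        simp only [eval, List.find?_cons, hq]
        exact ih _ T (by simpa using h) (by rintro (_ | a) <;> simp [hq, hs])

theorem mem_eval (w : ParamWord α n k) : ∀ (s : α → S) (T : List S), ∀ x ∈ eval s w T,
    x ∈ Set.range s ∨ x ∈ T := by
  induction w with
  | nil => intro s T x hx; simp [eval] at hx
  | cons a w ih =>
    intro s T x hx
    rcases List.mem_cons.1 hx with rfl | hx
    · exact .inl ⟨a, rfl⟩
    · exact ih s T x hx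
  | var w ih =>
    intro s T x hx
    cases T with
    | nil => simp [eval] at hx
    | cons t T =>
      rcases List.mem_cons.1 hx with rfl | hx
      · simp
      · rcases ih _ T x hx with ⟨_ | a, rfl⟩ | h <;> simp_all

/-- A list is obtained by substituting `T` in a parameter word if the entries of `T` occur in it
for the first time in the order of `T`, and all other entries are letters. -/
theorem exists_eval_eq (L : List S) : ∀ {α : Type} (s : α → S) (T : List S), T.Nodup →
    (∀ x ∈ T, x ∉ Set.range s) →
    (∀ q : S → Bool, (∀ a, q (s a) = false) → L.find? q = T.find? q) →
    ∃ v : ParamWord α L.length T.length, eval s v T = L := by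
  classical
  induction L with
  | nil =>
    intro α s T _ hT hq
    cases T with
    | nil => exact ⟨nil, rfl⟩
    | cons t T =>
      have := hq (fun x => decide (x ∉ Set.range s)) (by simp)
      rw [List.find?_cons_of_pos (by simpa using hT t (by simp))] at this
      simp at this
  | cons x L ih =>
    intro α s T hnd hT hq
    by_cases hx : x ∈ Set.range s
    · obtain ⟨a, rfl⟩ := hx
      obtain ⟨v, hv⟩ := ih s T hnd hT fun q hs => by simpa [hs] using hq q hs
      exact ⟨cons a v, by simp [eval, hv]⟩
    · have h := hq (fun x => decide (x ∉ Set.range s)) (by simp)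
      rw [List.find?_cons_of_pos (by simpa using hx)] at h
      cases T with
      | nil => simp at h
      | cons t T =>
        rw [List.find?_cons_of_pos (by simpa using hT t (by simp))] at h
        obtain rfl : x = t := by simpa using h
        obtain ⟨v, hv⟩ := ih (fun o : Option α => o.elim x s) T (List.nodup_cons.1 hnd).2 (by
            rintro y hy ⟨_ | a, rfl⟩
            · exact (List.nodup_cons.1 hnd).1 hy
            · exact hT _ (List.mem_cons_of_mem _ hy) ⟨a, rfl⟩) fun q hs => by
          have := hq q fun a => hs (some a)
          simpa [show q x = false from hs none] using this
        exact ⟨var v, by simp [eval, hv]⟩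

end ParamWord

section OrderedPoset

/-- Embeddings of linearly ordered sets with a further binary relation. -/
def IsOrderedEmb {A B : Type} [Preorder A] [Preorder B] (p : A → A → Prop) (q : B → B → Prop)
    (f : A → B) : Prop :=
  StrictMono f ∧ ∀ a b, p a b ↔ q (f a) (f b)

/-- Predicates that are closed upwards with respect to a relation. -/
def IsUpClosed {A : Type} (p : A → A → Prop) (U : Lex (A → Prop)) : Prop :=
  ∀ a b, p a b → ofLex U a → ofLex U b

variable {A B : Type}

instance [Finite A] : Finite (Lex (A → Prop)) :=
  inferInstanceAs (Finite (A → Prop))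

/-- The nonempty upwards closed sets, in lexicographic order. -/
noncomputable def upClosedList [Finite A] [LinearOrder A] (p : A → A → Prop) :
    List (Lex (A → Prop)) :=
  (Set.toFinite {U : Lex (A → Prop) | U ≠ toLex ⊥ ∧ IsUpClosed p U}).toFinset.sort

theorem mem_upClosedList [Finite A] [LinearOrder A] {p : A → A → Prop} {U : Lex (A → Prop)} :
    U ∈ upClosedList p ↔ U ≠ toLex ⊥ ∧ IsUpClosed p U := by
  simp [upClosedList]

theorem List.find?_eq_some_of_pairwise_le {S : Type} [PartialOrder S] {L : List S}
    (hL : L.Pairwise (· ≤ ·)) {q : S → Bool} {x : S} (hx : x ∈ L) (hq : q x = true)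
    (hmin : ∀ y ∈ L, q y = true → x ≤ y) : L.find? q = some x := by
  induction L with
  | nil => simp at hx
  | cons y L ih =>
    rw [List.pairwise_cons] at hL
    by_cases hy : q y = true
    · rw [List.find?_cons_of_pos hy]
      rcases List.mem_cons.1 hx with rfl | hx
      · rfl
      · rw [(hL.1 x hx).antisymm (hmin y (by simp) hy)]
    · rw [List.find?_cons_of_neg hy]
      rcases List.mem_cons.1 hx with rfl | hx
      · exact absurd hq hy
      · exact ih hL.2 hx fun z hz => hmin z (List.mem_cons_of_mem _ hz)

theorem List.le_of_find?_eq_some {S : Type} [PartialOrder S] {L : List S}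
    (hL : L.Pairwise (· ≤ ·)) {q : S → Bool} {x : S} (hx : L.find? q = some x) :
    ∀ y ∈ L, q y = true → x ≤ y := by
  induction L with
  | nil => simp at hx
  | cons z L ih =>
    rw [List.pairwise_cons] at hL
    intro y hy hq
    by_cases hz : q z = true
    · rw [List.find?_cons_of_pos hz] at hx
      obtain rfl : z = x := by simpa using hx
      rcases List.mem_cons.1 hy with rfl | hy
      · exact le_rfl
      · exact hL.1 y hy
    · rw [List.find?_cons_of_neg hz] at hx
      rcases List.mem_cons.1 hy with rfl | hy
      · exact absurd hq hz
      · exact ih hL.2 hx y hy hq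

theorem pairwise_upClosedList [Finite A] [LinearOrder A] (p : A → A → Prop) :
    (upClosedList p).Pairwise (· ≤ ·) :=
  Finset.pairwise_sort _ (· ≤ ·)

theorem nodup_upClosedList [Finite A] [LinearOrder A] (p : A → A → Prop) : (upClosedList p).Nodup :=
  Finset.sort_nodup _ (· ≤ ·)

theorem lex_prop_lt_iff [LinearOrder A] {U V : Lex (A → Prop)} :
    U < V ↔ ∃ i, (∀ j < i, (ofLex U j ↔ ofLex V j)) ∧ ¬ ofLex U i ∧ ofLex V i := by
  change (∃ i, (∀ j < i, ofLex U j = ofLex V j) ∧ ofLex U i < ofLex V i) ↔ _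
  simp only [eq_iff_iff, lt_iff_le_not_ge, le_Prop_eq]
  refine exists_congr fun i => and_congr_right fun _ => ?_
  tauto

/-- The preimage of a set under a map. -/
def lexPreimage {A B : Type} (f : A → B) (U : Lex (B → Prop)) : Lex (A → Prop) :=
  toLex (ofLex U ∘ f)

/-- The upwards closed set generated by the image of a set. -/
def upImage {A B : Type} (q : B → B → Prop) (f : A → B) (U : Lex (A → Prop)) : Lex (B → Prop) :=
  toLex fun b => ∃ a, ofLex U a ∧ (f a = b ∨ q (f a) b)

section

variable {p : A → A → Prop} {q : B → B → Prop} {f : A → B}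

theorem lexPreimage_upImage [LinearOrder A] [PartialOrder B] (hf : IsOrderedEmb p q f)
    {U : Lex (A → Prop)} (hU : IsUpClosed p U) :
    lexPreimage f (upImage q f U) = U := by
  funext a
  apply propext
  constructor
  · rintro ⟨a', h, e | e⟩
    · rwa [← hf.1.injective e]
    · exact hU a' a ((hf.2 _ _).2 e) h
  · exact fun h => ⟨a, h, .inl rfl⟩

theorem isUpClosed_upImage [IsStrictOrder B q] (U : Lex (A → Prop)) :
    IsUpClosed q (upImage q f U) := by
  rintro b b' h ⟨a, ha, rfl | e⟩
  · exact ⟨a, ha, .inr h⟩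
  · exact ⟨a, ha, .inr (_root_.trans e h)⟩

theorem isUpClosed_lexPreimage [Preorder A] [Preorder B] (hf : IsOrderedEmb p q f)
    {U : Lex (B → Prop)} (hU : IsUpClosed q U) : IsUpClosed p (lexPreimage f U) :=
  fun a b h => hU _ _ ((hf.2 a b).1 h)

theorem upImage_le_upImage [Finite A] [LinearOrder A] [Finite B] [LinearOrder B]
    (hf : IsOrderedEmb p q f) (hq : ∀ a b, q a b → a < b)
    {U V : Lex (A → Prop)} (hU : IsUpClosed p U) (h : U ≤ V) : upImage q f U ≤ upImage q f V := by
  rcases h.eq_or_lt with rfl | h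
  · exact le_rfl
  obtain ⟨i, hi, h1, h2⟩ := lex_prop_lt_iff.1 h
  suffices (∀ b < f i, (ofLex (upImage q f U) b ↔ ofLex (upImage q f V) b)) ∧
      ¬ ofLex (upImage q f U) (f i) from
    (lex_prop_lt_iff.2 ⟨f i, this.1, this.2, i, h2, .inl rfl⟩).le
  refine ⟨fun b hb => ?_, ?_⟩
  · refine exists_congr fun a => and_congr_left fun h =>
      hi a (hf.1.lt_iff_lt.1 (lt_of_le_of_lt ?_ hb))
    rcases h with h | h
    exacts [h.le, (hq _ _ h).le]
  · rintro ⟨a, ha, e | e⟩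
    · exact h1 (hf.1.injective e ▸ ha)
    · exact h1 (hU a i ((hf.2 _ _).2 e) ha)

theorem upImage_lexPreimage_le [Finite B] [LinearOrder B] {U : Lex (B → Prop)}
    (hU : IsUpClosed q U) :
    upImage q f (lexPreimage f U) ≤ U := by
  refine Pi.toLex_monotone (a := ofLex (upImage q f (lexPreimage f U))) (b := ofLex U) fun b => ?_
  rintro ⟨a, ha, rfl | e⟩
  exacts [ha, hU _ _ e ha]

theorem find?_map_lexPreimage [Finite A] [LinearOrder A] [Finite B] [LinearOrder B]
    [IsStrictOrder B q] (hf : IsOrderedEmb p q f)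
    (hq : ∀ a b, q a b → a < b) (Q : Lex (A → Prop) → Bool) (hQ : Q (toLex ⊥) = false) :
    ((upClosedList q).map (lexPreimage f)).find? Q = (upClosedList p).find? Q := by
  have key : ∀ U ∈ upClosedList q, Q (lexPreimage f U) = true →
      lexPreimage f U ∈ upClosedList p := fun U hU h =>
    mem_upClosedList.2 ⟨fun e => by simp [e, hQ] at h,
      isUpClosed_lexPreimage hf (mem_upClosedList.1 hU).2⟩
  rw [List.find?_map]
  cases h : (upClosedList p).find? Q with
  | none =>
    rw [List.find?_eq_none] at h
    rw [List.find?_eq_none (p := Q ∘ lexPreimage f) |>.2 fun U hU h' => h _ (key U hU h') h',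
      Option.map_none]
  | some V =>
    obtain ⟨hV0, hV⟩ := mem_upClosedList.1 (List.mem_of_find?_eq_some h)
    have e := lexPreimage_upImage hf hV
    rw [List.find?_eq_some_of_pairwise_le (pairwise_upClosedList q) (x := upImage q f V),
      Option.map_some, e]
    · refine mem_upClosedList.2 ⟨fun h0 => hV0 ?_, isUpClosed_upImage V⟩
      rw [← e, h0]
      rfl
    · simpa [e] using List.find?_some h
    · intro U hU h'
      exact (upImage_le_upImage hf hq hV
        (List.le_of_find?_eq_some (pairwise_upClosedList p) h _ (key U hU h') h')).trans
        (upImage_lexPreimage_le (mem_upClosedList.1 hU).2)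

end

/-- The pointwise strict order on a power of `Prop`. -/
def pointwiseLT {ι : Type} (x y : Lex (ι → Prop)) : Prop :=
  ofLex x < ofLex y

/-- The map that sends a point to the positions of the sets in a list that contain it. -/
def incidence {A : Type} (n : ℕ) (L : List (Lex (A → Prop))) (a : A) : Lex (Fin n → Prop) :=
  toLex fun i => ofLex (L.getD i (toLex ⊥)) a

theorem incidence_comp {A B : Type} (n : ℕ) (L : List (Lex (B → Prop))) (f : A → B) :
    incidence n L ∘ f = incidence n (L.map (lexPreimage f)) := by
  funext a i
  change ofLex (L.getD i (toLex ⊥)) (f a) = ofLex ((L.map (lexPreimage f)).getD i (toLex ⊥)) a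
  rw [show (toLex ⊥ : Lex (A → Prop)) = lexPreimage f (toLex ⊥) from rfl, List.getD_map]
  rfl

theorem isOrderedEmb_incidence [Finite A] [LinearOrder A] {p : A → A → Prop}
    [IsStrictOrder A p] (hp : ∀ a b, p a b → a < b)
    {L : List (Lex (A → Prop))} {n : ℕ} (hn : L.length = n) (hL : ∀ U ∈ L, IsUpClosed p U)
    (h : ∀ Q : Lex (A → Prop) → Bool, Q (toLex ⊥) = false →
      L.find? Q = (upClosedList p).find? Q) :
    IsOrderedEmb p pointwiseLT (incidence n L) := by
  classical
  subst hn
  have hinc : ∀ (a : A) (i : Fin L.length), ofLex (incidence L.length L a) i = ofLex L[i] a :=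
    fun a i => by simp [incidence]
  have hmono : StrictMono (incidence L.length L) := by
    intro a b hab
    let V : Lex (A → Prop) := toLex fun x => b ≤ x
    have hV : V ∈ upClosedList p := mem_upClosedList.2
      ⟨fun e => by simpa using (congrFun e b).mp le_rfl, fun x y hxy hx => hx.trans (hp _ _ hxy).le⟩
    let Q : Lex (A → Prop) → Bool := fun U => decide (¬(ofLex U a ↔ ofLex U b))
    have hQV : Q V = true := by simp [Q, V, hab]
    obtain ⟨U, hU⟩ : ∃ U, (upClosedList p).find? Q = some U :=
      Option.isSome_iff_exists.1 (List.find?_isSome.2 ⟨V, hV, hQV⟩)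
    have hle := List.le_of_find?_eq_some (pairwise_upClosedList p) hU V hV hQV
    have hQU : ¬(ofLex U a ↔ ofLex U b) := 
      of_decide_eq_true (List.find?_some hU :)
    rw [← h Q (by simp [Q]), List.find?_eq_some_iff_getElem] at hU
    obtain ⟨-, i, hi, rfl, hlt⟩ := hU
    refine lex_prop_lt_iff.2 ⟨⟨i, hi⟩, fun j hj => ?_, ?_⟩
    · rw [hinc, hinc]
      have := hlt j hj
      simp only [Bool.not_eq_true', Q] at this
      exact not_not.1 (of_decide_eq_false this)
    · rw [hinc, hinc]
      by_contra hc
      have ha : ofLex L[i] a ∧ ¬ ofLex L[i] b := by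
        change ¬(¬ ofLex L[i] a ∧ ofLex L[i] b) at hc
        tauto
      rcases hle.eq_or_lt with e | hlt
      · rw [e] at ha
        exact ha.2 le_rfl
      · obtain ⟨c, hc, -, hbc⟩ := lex_prop_lt_iff.1 hlt
        exact hab.not_ge ((hc a (hab.trans_le hbc)).1 ha.1)
  refine ⟨hmono, fun a b => ⟨fun hab => ?_, fun hab => ?_⟩⟩
  · refine lt_of_le_of_ne (fun i => ?_) fun e => (hmono (hp a b hab)).ne e
    rw [hinc, hinc]
    exact hL _ (List.getElem_mem _) a b hab
  · let V : Lex (A → Prop) := toLex fun x => a = x ∨ p a x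
    have hV : V ∈ upClosedList p := by
      refine mem_upClosedList.2 ⟨fun e => by simpa using (congrFun e a).mp (.inl rfl), ?_⟩
      rintro x y hxy (rfl | hx)
      exacts [.inr hxy, .inr (_root_.trans hx hxy)]
    have hVL : V ∈ L := by
      have hs : (L.find? fun U => decide (U = V)).isSome := by
        rw [h _ (by simpa using (mem_upClosedList.1 hV).1.symm)]
        exact List.find?_isSome.2 ⟨V, hV, by simp⟩
      obtain ⟨U, hU, e⟩ := List.find?_isSome.1 hs
      simpa [show U = V by simpa using e] using hU
    obtain ⟨i, hi, e⟩ := List.getElem_of_mem hVL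
    have := hab.le ⟨i, hi⟩
    rw [hinc, hinc] at this
    simp only [Fin.getElem_fin, e] at this
    rcases this (.inl rfl) with rfl | h'
    · exact absurd hab (lt_irrefl _)
    · exact h'

/-- The Ramsey property of finite posets with a linear extension: the copies of `A` are coloured
by a colouring of all maps. -/
theorem exists_mono_isOrderedEmb [Finite A] [LinearOrder A] [Finite B] [LinearOrder B]
    (p : A → A → Prop) (q : B → B → Prop) [IsStrictOrder B q] (hq : ∀ a b, q a b → a < b)
    (κ : Type) [Finite κ] [Nonempty κ] :
    ∃ n, ∀ χ : (A → Lex (Fin n → Prop)) → κ, ∃ g : B → Lex (Fin n → Prop),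
      IsOrderedEmb q pointwiseLT g ∧ ∃ d, ∀ f, IsOrderedEmb p q f → χ (g ∘ f) = d := by
  obtain ⟨n, hn⟩ := ParamWord.exists_mono_comp (upClosedList p).length Unit κ (upClosedList q).length
  refine ⟨n, fun χ => ?_⟩
  obtain ⟨w, d, hw⟩ :=
    hn fun w => χ (incidence n (ParamWord.eval (fun _ => toLex ⊥) w (upClosedList p)))
  refine ⟨incidence n (ParamWord.eval (fun _ => toLex ⊥) w (upClosedList q)),
    isOrderedEmb_incidence hq (ParamWord.length_eval _ _ _ rfl) ?_ ?_, d, fun f hf => ?_⟩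
  · intro U hU
    rcases ParamWord.mem_eval _ _ _ U hU with ⟨_, rfl⟩ | h
    · exact fun _ _ _ h => h
    · exact (mem_upClosedList.1 h).2
  · exact fun Q hQ => ParamWord.find?_eval _ _ _ _ rfl fun _ => hQ
  · obtain ⟨v, hv⟩ := ParamWord.exists_eval_eq ((upClosedList q).map (lexPreimage f))
      (fun _ : Unit => (toLex ⊥ : Lex (A → Prop))) (upClosedList p) (nodup_upClosedList p)
      (by rintro x hx ⟨_, rfl⟩; exact (mem_upClosedList.1 hx).1 rfl)
      (fun Q hQ => find?_map_lexPreimage hf hq Q (hQ ()))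
    generalize hl : ((upClosedList q).map (lexPreimage f)).length = l at v
    rw [List.length_map] at hl
    subst hl
    rw [incidence_comp, ParamWord.map_eval, ← hw v, ParamWord.eval_comp, hv]
    rfl

/-- The Ramsey property of finite posets with a linear extension, for unbundled orders. -/
theorem exists_mono_comp_of_strictTotalOrder [Finite A] [Finite B]
    {p l : A → A → Prop} (_ : IsStrictTotalOrder A l) {q m : B → B → Prop} (_ : IsStrictOrder B q)
    (_ : IsStrictTotalOrder B m) (hq : ∀ a b, q a b → m a b)
    (κ : Type) [Finite κ] [Nonempty κ] :
    ∃ n, ∀ χ : (A → Lex (Fin n → Prop)) → κ, ∃ g : B → Lex (Fin n → Prop),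
      Function.Injective g ∧ (∀ a b, m a b ↔ g a < g b) ∧
      (∀ a b, q a b ↔ pointwiseLT (g a) (g b)) ∧
      ∃ d, ∀ f : A → B, (∀ a b, l a b ↔ m (f a) (f b)) → (∀ a b, p a b ↔ q (f a) (f b)) →
        χ (g ∘ f) = d := by
  classical
  let _ := linearOrderOfSTO l
  let _ := linearOrderOfSTO m
  obtain ⟨n, hn⟩ := exists_mono_isOrderedEmb p q hq κ
  refine ⟨n, fun χ => ?_⟩
  obtain ⟨g, hg, d, hd⟩ := hn χ
  exact ⟨g, hg.1.injective, fun a b => hg.1.lt_iff_lt.symm, hg.2, d,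
    fun f hl hf => hd f ⟨fun a b h => (hl a b).1 h, hf⟩⟩

theorem lt_of_pointwiseLT {n : ℕ} {x y : Lex (Fin n → Prop)} (h : pointwiseLT x y) : x < y :=
  Pi.toLex_strictMono h

theorem isStrictOrder_pointwiseLT_comp {X ι : Type} (f : X → Lex (ι → Prop)) :
    IsStrictOrder X fun x y => pointwiseLT (f x) (f y) where
  irrefl x := lt_irrefl (ofLex (f x))
  trans _ _ _ h h' := lt_trans (α := ι → Prop) h h'

theorem isStrictTotalOrder_lt_comp {X Y : Type} [LinearOrder Y] {f : X → Y}
    (hf : Function.Injective f) : IsStrictTotalOrder X fun x y => f x < f y :=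
  (RelEmbedding.preimage ⟨f, hf⟩ (· < ·)).isStrictTotalOrder

end OrderedPoset

theorem BinEmb.ext {ι : Type} {A B : BinStr ι} {f g : BinEmb A B} (h : f.toFun = g.toFun) :
    f = g := by
  cases f; cases g; cases h; rfl

/-- The product of two powers of `Prop`, with the pointwise and the lexicographic orders of the
factors, where ties of the linear orders are resolved by the other factor. -/
def prodStr (m n : ℕ) : BinStr (Fin 4) where
  carrier := Lex (Fin m → Prop) × Lex (Fin n → Prop)
  rel := ![fun x y => pointwiseLT x.1 y.1, fun x y => toLex x < toLex y,
    fun x y => pointwiseLT x.2 y.2, fun x y => toLex x.swap < toLex y.swap]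

/-- The class of all finite structures `(X, ≺₁, <₁, ≺₂, <₂)`, where `≺₁` (index 0) and `≺₂`
(index 2) are strict partial orders, `<₁` (index 1) is a strict linear order extending `≺₁`,
and `<₂` (index 3) is a strict linear order extending `≺₂`, has the Ramsey property. -/
theorem statement6 :
    BinRamseyClass {A : BinStr (Fin 4) |
      Finite A.carrier ∧
        IsStrictOrder A.carrier (A.rel 0) ∧
        IsStrictTotalOrder A.carrier (A.rel 1) ∧
        (∀ x y : A.carrier, A.rel 0 x y → A.rel 1 x y) ∧
        IsStrictOrder A.carrier (A.rel 2) ∧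
        IsStrictTotalOrder A.carrier (A.rel 3) ∧
        (∀ x y : A.carrier, A.rel 2 x y → A.rel 3 x y)} := by
  rintro A ⟨_, -, hA1, -, -, hA3, -⟩ B hB r
  cases r with
  | zero =>
    exact ⟨B, hB, fun χ => ⟨⟨id, Function.injective_id, fun _ _ _ => Iff.rfl⟩,
      fun f₁ _ => (χ f₁).elim0⟩⟩
  | succ r =>
    classical
    obtain ⟨_, hB0, hB1, hB01, hB2, hB3, hB23⟩ := hB
    obtain ⟨n₁, h₁⟩ :=
      exists_mono_comp_of_strictTotalOrder (p := A.rel 0) hA1 hB0 hB1 hB01 (Fin (r + 1))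
    obtain ⟨n₂, h₂⟩ := exists_mono_comp_of_strictTotalOrder (p := A.rel 2) hA3 hB2 hB3 hB23
      ((A.carrier → Lex (Fin n₁ → Prop)) → Fin (r + 1))
    refine ⟨prodStr n₁ n₂, ⟨?_, ?_, ?_, ?_, ?_, ?_, ?_⟩, fun χ => ?_⟩
    · exact inferInstanceAs (Finite (Lex (Fin n₁ → Prop) × Lex (Fin n₂ → Prop)))
    · exact isStrictOrder_pointwiseLT_comp Prod.fst
    · exact isStrictTotalOrder_lt_comp toLex.injective
    · exact fun x y h => Prod.Lex.toLex_lt_toLex.2 (.inl (lt_of_pointwiseLT h))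
    · exact isStrictOrder_pointwiseLT_comp Prod.snd
    · exact isStrictTotalOrder_lt_comp (toLex.injective.comp Prod.swap_injective)
    · exact fun x y h => Prod.Lex.toLex_lt_toLex.2 (.inl (lt_of_pointwiseLT h))
    · let χ' (f₁ : A.carrier → Lex (Fin n₁ → Prop)) (f₂ : A.carrier → Lex (Fin n₂ → Prop)) :
          Fin (r + 1) :=
        if h : ∃ e : BinEmb A (prodStr n₁ n₂), e.toFun = fun a => (f₁ a, f₂ a) then χ h.choose
        else 0
      obtain ⟨g₂, hinj₂, hg3, hg2, d₂, hd₂⟩ := h₂ fun f₂ f₁ => χ' f₁ f₂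
      obtain ⟨g₁, hinj₁, hg1, hg0, d₁, hd₁⟩ := h₁ d₂
      let g : BinEmb B (prodStr n₁ n₂) :=
        { toFun := fun b => (g₁ b, g₂ b)
          inj := fun a b h => hinj₁ (congrArg Prod.fst h)
          map_rel := fun i x y => by
            fin_cases i
            · exact hg0 x y
            · refine (hg1 x y).trans (Iff.trans ?_ Prod.Lex.toLex_lt_toLex.symm)
              exact ⟨.inl, fun h => h.elim id fun h => absurd h.2 (hinj₁ h.1 ▸ lt_irrefl _)⟩
            · exact hg2 x y
            · refine (hg3 x y).trans (Iff.trans ?_ Prod.Lex.toLex_lt_toLex.symm)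
              exact ⟨.inl, fun h => h.elim id fun h => absurd h.2 (hinj₂ h.1 ▸ lt_irrefl _)⟩ }
      have key (f : BinEmb A B) : χ (g.comp f) = d₁ := by
        rw [← hd₁ f.toFun (f.map_rel 1) (f.map_rel 0), ← hd₂ f.toFun (f.map_rel 3) (f.map_rel 2)]
        have h : ∃ e : BinEmb A (prodStr n₁ n₂),
            e.toFun = fun a => ((g₁ ∘ f.toFun) a, (g₂ ∘ f.toFun) a) := ⟨g.comp f, rfl⟩
        change _ = χ' (g₁ ∘ f.toFun) (g₂ ∘ f.toFun)
        rw [show χ' (g₁ ∘ f.toFun) (g₂ ∘ f.toFun) = χ h.choose from dif_pos h]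
        exact congrArg χ (BinEmb.ext h.choose_spec.symm)
      exact ⟨g, fun f₁ f₂ => (key f₁).trans (key f₂).symm⟩
end
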